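/- arXiv:1504.07696 — 4 statements merged into one kernel-verified Lean document; each statement's English description precedes it below -/
import Mathlib

section
/- For every l ≥ 1, ζ({3,1}^l) = 2π^{4l}/(4l+2)!. -/
open scoped BigOperators Real

/-- ζ({3,1}^l) = ∑_{n_1 > m_1 > ⋯ > n_l > m_l ≥ 1} ∏_j 1/(n_j³ m_j). -/
noncomputable def zetaThreeOneRep (l : ℕ) : ℝ :=
  ∑' p : {p : (Fin l → ℕ) × (Fin l → ℕ) //
      (∀ i, p.2 i < p.1 i) ∧ (∀ i j, i < j → p.1 j < p.2 i) ∧ ∀ i, 1 ≤ p.2 i},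
    ∏ i : Fin l, (1 : ℝ) / ((p.1.1 i : ℝ) ^ 3 * (p.1.2 i : ℝ))

/-- Partial products. -/
noncomputable def zSP (z : ℂ) (n : ℕ) : ℂ := ∏ j ∈ Finset.range n, (1 - z / ((j : ℂ) + 1) ^ 2)

/-- Coefficients of F(α,-α;1;t), z = α². -/
noncomputable def zSA (z : ℂ) : ℕ → ℂ
  | 0 => 1
  | n + 1 => -z / ((n : ℂ) + 1) ^ 2 * zSP z n

lemma zSA_sum (z : ℂ) (n : ℕ) : ∑ j ∈ Finset.range (n + 1), zSA z j = zSP z n := by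
  induction n with
  | zero => simp [zSA, zSP]
  | succ n ih =>
    rw [Finset.sum_range_succ, ih, zSP, zSP, Finset.prod_range_succ, ← zSP, zSA]
    ring

open PowerSeries in
lemma zSA_ode (z : ℂ) :
    (1 - X) * derivative ℂ (X * derivative ℂ (PowerSeries.mk (zSA z))) =
      - (C z * PowerSeries.mk (zSA z)) := by
  have h0 : derivative ℂ (X * derivative ℂ (PowerSeries.mk (zSA z))) =
      PowerSeries.mk (fun n => - z * zSP z n) := by
    ext n
    rw [coeff_derivative, coeff_succ_X_mul, coeff_derivative, coeff_mk, coeff_mk, zSA]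
    have : (n : ℂ) + 1 ≠ 0 := Nat.cast_add_one_ne_zero n
    field_simp
  rw [h0]
  ext n
  rw [sub_mul, one_mul, map_sub, map_neg, coeff_C_mul, coeff_mk, coeff_mk]
  cases n with
  | zero => simp [zSP, zSA]
  | succ n =>
    rw [coeff_succ_X_mul, coeff_mk, ← zSA_sum, ← zSA_sum, Finset.sum_range_succ _ (n + 1)]
    ring

open PowerSeries in
lemma zSum_of_ode (F G : PowerSeries ℂ) (h : (1 - X) * derivative ℂ F = G) (n : ℕ) :
    (n : ℂ) * coeff n F = ∑ k ∈ Finset.range n, coeff k G := by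
  induction n with
  | zero => simp
  | succ n ih =>
    rw [Finset.sum_range_succ, ← ih, ← h, sub_mul, one_mul, map_sub, coeff_derivative]
    cases n with
    | zero => simp
    | succ n => rw [coeff_succ_X_mul, coeff_derivative]; push_cast; ring

/-- Coefficients of the product. -/
noncomputable def zY (z : ℂ) (n : ℕ) : ℂ :=
  ∑ kl ∈ Finset.HasAntidiagonal.antidiagonal n, zSA z kl.1 * zSA (-z) kl.2

open PowerSeries in
lemma zY_rec (z : ℂ) (n : ℕ) (hn : n ≠ 0) :
    zY z n = 1 / (n : ℂ) ^ 3 * ∑ k ∈ Finset.range n, 1 / (k : ℂ) *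
      ∑ j ∈ Finset.range k, (-4 * z ^ 2) * zY z j := by
  set A := PowerSeries.mk (zSA z) with hA
  set B := PowerSeries.mk (zSA (-z)) with hB
  have oA := zSA_ode z
  have oB := zSA_ode (-z)
  rw [← hA] at oA
  rw [← hB] at oB
  have hY : ∀ n, coeff n (A * B) = zY z n := by
    intro n
    simp [coeff_mul, hA, hB, zY]
  rw [map_neg, neg_mul, neg_neg] at oB
  set A1 := X * derivative ℂ A with hA1
  set B1 := X * derivative ℂ B with hB1
  set U : PowerSeries ℂ := 2 * (A1 * B1) with hU
  set V : PowerSeries ℂ := 2 * C z * (A1 * B - A * B1) with hV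
  clear_value A B A1 B1 U V
  have dX : derivative ℂ (X : PowerSeries ℂ) = 1 := derivative_X
  have d2 : derivative ℂ (2 : PowerSeries ℂ) = 0 := by
    have : (2 : PowerSeries ℂ) = C (2 : ℂ) := (map_ofNat C 2).symm
    rw [this]; exact derivative_C
  have dz : derivative ℂ (C z : PowerSeries ℂ) = 0 := derivative_C
  have e1 : X * derivative ℂ (X * derivative ℂ (A * B)) = U := by
    have hx : (1 - X : PowerSeries ℂ) ≠ 0 := by
      intro h
      have := congrArg (coeff 0) h
      simp at this
    apply mul_left_cancel₀ hx
    have : X * derivative ℂ (A * B) = A * B1 + B * A1 := by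
      rw [Derivation.leibniz]; simp only [smul_eq_mul, hA1, hB1]; ring
    rw [this, map_add, Derivation.leibniz, Derivation.leibniz]
    simp only [smul_eq_mul]
    have : (1 - X) * (X * (A * derivative ℂ B1 + B1 * derivative ℂ A + (B * derivative ℂ A1 + A1 * derivative ℂ B))) =
      X * A * ((1 - X) * derivative ℂ B1) + X * B * ((1 - X) * derivative ℂ A1)
       + (1 - X) * (B1 * (X * derivative ℂ A) + A1 * (X * derivative ℂ B)) := by ring
    rw [this, oA, oB, ← hA1, ← hB1, hU]
    ring
  have e2 : (1 - X) * derivative ℂ U = V := by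
    rw [hU, Derivation.leibniz, Derivation.leibniz, d2]
    simp only [smul_eq_mul]
    linear_combination 2 * A1 * oB + 2 * B1 * oA - hV
  have e3 : (1 - X) * derivative ℂ V = C (-4 * z ^ 2) * (A * B) := by
    rw [hV, Derivation.leibniz, Derivation.leibniz, map_sub, Derivation.leibniz,
      Derivation.leibniz, d2, dz]
    have hC : (C (-4 * z ^ 2) : PowerSeries ℂ) = - 4 * C z ^ 2 := by
      rw [map_mul, map_neg, map_pow, map_ofNat C 4]
    rw [hC]
    simp only [smul_eq_mul]
    linear_combination 2 * C z * (B * oA - A * oB) + 2 * C z * (1 - X) * (derivative ℂ B * hA1 - derivative ℂ A * hB1)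
  have c1 : (n : ℂ) ^ 2 * zY z n = coeff n U := by
    obtain ⟨m, rfl⟩ := Nat.exists_eq_succ_of_ne_zero hn
    rw [← e1, Nat.succ_eq_add_one, coeff_succ_X_mul, coeff_derivative, coeff_succ_X_mul, coeff_derivative, hY]
    push_cast; ring
  have c2 := zSum_of_ode U V e2 n
  have c3 := fun k => zSum_of_ode V _ e3 k
  have hn' : (n : ℂ) ≠ 0 := Nat.cast_ne_zero.mpr hn
  have : (n : ℂ) ^ 3 * zY z n = ∑ k ∈ Finset.range n, 1 / (k : ℂ) *
      ∑ j ∈ Finset.range k, (-4 * z ^ 2) * zY z j := by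
    rw [pow_succ', mul_assoc, c1, c2]
    apply Finset.sum_congr rfl
    intro k _
    by_cases hk : k = 0
    · subst hk
      simp [hV, hA1, hB1, coeff_zero_eq_constantCoeff]
    · have hk' : (k : ℂ) ≠ 0 := Nat.cast_ne_zero.mpr hk
      have := c3 k
      simp only [coeff_C_mul, hY] at this
      rw [← this]
      field_simp
  rw [← this]
  field_simp

lemma zSA_hasSum (a : ℂ) (ha : a ≠ 0) :
    (Summable fun n => ‖zSA (a ^ 2) n‖) ∧
      HasSum (zSA (a ^ 2)) (Complex.sin (π * a) / (π * a)) := by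
  have hpa : (π : ℂ) * a ≠ 0 := mul_ne_zero (by exact_mod_cast Real.pi_ne_zero) ha
  have ht : Filter.Tendsto (zSP (a ^ 2)) Filter.atTop (nhds (Complex.sin (π * a) / (π * a))) := by
    have := (Complex.tendsto_euler_sin_prod a).div_const (π * a)
    refine this.congr fun n => ?_
    rw [mul_div_cancel_left₀ _ hpa, zSP]
  have hs : Summable fun n => ‖zSA (a ^ 2) n‖ := by
    obtain ⟨M, hM⟩ := ht.norm.bddAbove_range
    rw [← summable_nat_add_iff 1]
    have h2 : Summable fun n : ℕ => ‖a ^ 2‖ * M * (1 / ((n + 1 : ℕ) : ℝ) ^ 2) := by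
      apply Summable.mul_left
      exact (summable_nat_add_iff 1).mpr (Real.summable_one_div_nat_pow.mpr one_lt_two)
    refine Summable.of_nonneg_of_le (fun _ => norm_nonneg _) (fun n => ?_) h2
    have h3 : ‖zSP (a ^ 2) n‖ ≤ M := hM ⟨n, rfl⟩
    have h4 : ‖(n : ℂ) + 1‖ = ((n + 1 : ℕ) : ℝ) := by
      rw [← Nat.cast_add_one, Complex.norm_natCast]
    rw [zSA, norm_mul, norm_div, norm_neg, norm_pow ((n : ℂ) + 1), h4]
    calc _ ≤ ‖a ^ 2‖ / ((n + 1 : ℕ) : ℝ) ^ 2 * M := by gcongr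
      _ = _ := by ring
  refine ⟨hs, ?_⟩
  have h1 := hs.of_norm.hasSum
  have h2 := (Filter.tendsto_add_atTop_iff_nat 1).mpr h1.tendsto_sum_nat
  simp only [zSA_sum] at h2
  rwa [tendsto_nhds_unique h2 ht] at h1

lemma zY_hasSum (x : ℝ) (hx : 0 < x) :
    HasSum (zY (((1 + Complex.I) * x / 2) ^ 2))
      (((Real.cosh (π * x) - Real.cos (π * x)) / (π * x) ^ 2 : ℝ) : ℂ) := by
  have hxc : (x : ℂ) ≠ 0 := by exact_mod_cast hx.ne'
  have hpc : (π : ℂ) ≠ 0 := by exact_mod_cast Real.pi_ne_zero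
  have hp : (1 + Complex.I) ≠ 0 := by
    intro h; have := congrArg Complex.re h; simp at this
  have hm : (1 - Complex.I) ≠ 0 := by
    intro h; have := congrArg Complex.re h; simp at this
  obtain ⟨sa, ha⟩ := zSA_hasSum ((1 + Complex.I) * x / 2) (div_ne_zero (mul_ne_zero hp hxc) two_ne_zero)
  obtain ⟨sb, hb⟩ := zSA_hasSum ((1 - Complex.I) * x / 2) (div_ne_zero (mul_ne_zero hm hxc) two_ne_zero)
  have hI := Complex.I_sq
  have e : ((1 - Complex.I) * x / 2) ^ 2 = -((1 + Complex.I) * x / 2) ^ 2 := by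
    linear_combination (x : ℂ) ^ 2 / 2 * hI
  rw [e] at sb hb
  have h1 := tsum_mul_tsum_eq_tsum_sum_antidiagonal_of_summable_norm sa sb
  have h2 := (summable_norm_sum_mul_antidiagonal_of_summable_norm sa sb).of_norm.hasSum
  rw [← h1, ha.tsum_eq, hb.tsum_eq] at h2
  refine Eq.subst (motive := fun c => HasSum _ c) ?_ h2
  symm
  push_cast
  have h3 := Complex.cos_sub_cos (π * x * Complex.I) (π * x)
  rw [Complex.cos_mul_I] at h3
  rw [h3]
  have e1 : ((π * x * Complex.I + π * x) / 2 : ℂ) = π * ((1 + Complex.I) * x / 2) := by ring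
  have e2 : ((π * x * Complex.I - π * x) / 2 : ℂ) = - (π * ((1 - Complex.I) * x / 2)) := by ring
  rw [e1, e2, Complex.sin_neg]
  have h5 : (π * ((1 + Complex.I) * x / 2)) * (π * ((1 - Complex.I) * x / 2)) = ((π : ℂ) * x) ^ 2 / 2 := by
    linear_combination - (π : ℂ) ^ 2 * x ^ 2 / 4 * hI
  rw [div_mul_div_comm, h5]
  field_simp

lemma z_hasSum_congr {M : Type*} [AddCommMonoid M] [TopologicalSpace M] {f g : ℕ → M} {a : M}
    (h : ∀ n, f n = g n) : HasSum f a ↔ HasSum g a := by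
  rw [funext h]

/-- Coefficients c l n : sum over chains with largest entry n. -/
noncomputable def zc : ℕ → ℕ → ℝ
  | 0, n => if n = 0 then 1 else 0
  | l + 1, n => 1 / (n : ℝ) ^ 3 * ∑ k ∈ Finset.range n, 1 / (k : ℝ) * ∑ j ∈ Finset.range k, zc l j

lemma zc_nonneg (l n : ℕ) : 0 ≤ zc l n := by
  induction l generalizing n with
  | zero => rw [zc]; split_ifs <;> norm_num
  | succ l ih =>
    rw [zc]
    exact mul_nonneg (by positivity) (Finset.sum_nonneg fun k _ =>
      mul_nonneg (by positivity) (Finset.sum_nonneg fun j _ => ih j))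

lemma zc_eq_zero (l n : ℕ) (h : n < l) : zc l n = 0 := by
  induction l generalizing n with
  | zero => omega
  | succ l ih =>
    rw [zc]
    rw [Finset.sum_eq_zero, mul_zero]
    intro k hk
    rw [Finset.sum_eq_zero, mul_zero]
    intro j hj
    rw [Finset.mem_range] at hk hj
    exact ih j (by omega)

lemma zc_gen_rec (w : ℝ) (M n : ℕ) (hn : n ≠ 0) :
    ∑ l ∈ Finset.range (M + 1), w ^ l * zc l n = 1 / (n : ℝ) ^ 3 *
      ∑ k ∈ Finset.range n, 1 / (k : ℝ) *
      ∑ j ∈ Finset.range k, w * ∑ l ∈ Finset.range M, w ^ l * zc l j := by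
  rw [Finset.sum_range_succ']
  have h0 : zc 0 n = 0 := by simp [zc, hn]
  rw [h0]
  simp only [zc, Finset.mul_sum]
  rw [mul_zero, add_zero, Finset.sum_comm]
  apply Finset.sum_congr rfl
  intro k _
  rw [Finset.sum_comm]
  apply Finset.sum_congr rfl
  intro j _
  apply Finset.sum_congr rfl
  intro l _
  ring

lemma zY_eq_zc (z : ℂ) (w : ℝ) (hw : (w : ℂ) = -4 * z ^ 2) (M n : ℕ) (hM : n < M) :
    zY z n = ((∑ l ∈ Finset.range M, w ^ l * zc l n : ℝ) : ℂ) := by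
  induction n using Nat.strong_induction_on generalizing M with
  | _ n ih =>
    obtain ⟨M, rfl⟩ : ∃ M', M = M' + 1 := ⟨M - 1, by omega⟩
    by_cases hn : n = 0
    · subst hn
      rw [Finset.sum_range_succ', Finset.sum_eq_zero]
      · simp [zY, zSA, zc]
      · intro l _
        rw [zc_eq_zero _ _ (by omega), mul_zero]
    · rw [zY_rec z n hn, zc_gen_rec w M n hn]
      push_cast
      congr 1
      apply Finset.sum_congr rfl
      intro k hk
      congr 1
      apply Finset.sum_congr rfl
      intro j hj
      rw [Finset.mem_range] at hk hj
      rw [ih j (by omega) M (by omega), hw]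
      push_cast
      rw [hw]

open ENNReal in
lemma zc_swap (w : ℝ) (hw : 0 ≤ w) (R : ℝ)
    (h : HasSum (fun n => ∑ l ∈ Finset.range (n + 1), w ^ l * zc l n) R) :
    ∑' l, ENNReal.ofReal (w ^ l) * ∑' n, ENNReal.ofReal (zc l n) = ENNReal.ofReal R := by
  have hnn : ∀ l n, 0 ≤ w ^ l * zc l n := fun l n => mul_nonneg (pow_nonneg hw l) (zc_nonneg l n)
  rw [← h.tsum_eq, ENNReal.ofReal_tsum_of_nonneg
    (fun n => Finset.sum_nonneg fun l _ => hnn l n) h.summable]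
  simp_rw [← ENNReal.tsum_mul_left]
  rw [ENNReal.tsum_comm]
  congr 1
  ext1 n
  rw [ENNReal.ofReal_sum_of_nonneg (fun l _ => hnn l n), tsum_eq_sum (s := Finset.range (n + 1))]
  · apply Finset.sum_congr rfl
    intro l _
    rw [ENNReal.ofReal_mul (pow_nonneg hw l)]
  · intro l hl
    rw [zc_eq_zero l n (by simpa using hl)]
    simp

lemma zR_hasSum (y : ℝ) (hy : 0 < y) :
    HasSum (fun l : ℕ => 2 * y ^ (4 * l) / (Nat.factorial (4 * l + 2)))
      ((Real.cosh y - Real.cos y) / y ^ 2) := by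
  have h := ((Real.hasSum_cosh y).sub (Real.hasSum_cos y)).div_const (y ^ 2)
  rw [← Function.Injective.hasSum_iff (g := fun l : ℕ => 2 * l + 1)] at h
  · refine (z_hasSum_congr fun l => ?_).mpr h
    have e1 : 2 * (2 * l + 1) = 4 * l + 2 := by ring
    have e2 : (-1 : ℝ) ^ (2 * l + 1) = -1 := by rw [pow_succ, pow_mul]; simp
    simp only [Function.comp, e1, e2]
    field_simp
    ring
  · intro a b hab
    simpa using hab
  · intro n hn
    have : Even n := by
      rcases Nat.even_or_odd' n with ⟨k, rfl | rfl⟩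
      · simp
      · exact absurd ⟨k, rfl⟩ hn
    simp [this.neg_one_pow]

lemma z_coeff_unique (d : ℕ → ℝ) (h : ∀ w : ℝ, 0 < w → HasSum (fun l => w ^ l * d l) 0) :
    d = 0 := by
  set f : ℝ → ℝ := fun w => ∑' l, w ^ l * d l
  have hs : ∀ w : ℝ, Summable fun l => w ^ l * d l := by
    intro w
    rw [← summable_norm_iff]
    have := (h (|w| + 1) (by positivity)).summable.norm
    refine Summable.of_nonneg_of_le (fun _ => norm_nonneg _) (fun n => ?_) this
    rw [norm_mul, norm_mul, norm_pow, norm_pow, Real.norm_eq_abs w,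
      Real.norm_of_nonneg (show 0 ≤ |w| + 1 by positivity)]
    gcongr
    linarith
  have hf : HasFPowerSeriesAt f (FormalMultilinearSeries.ofScalars ℝ d) 0 := by
    rw [hasFPowerSeriesAt_iff]
    refine Filter.Eventually.of_forall fun w => ?_
    simp only [FormalMultilinearSeries.coeff_ofScalars, smul_eq_mul, zero_add]
    exact (hs w).hasSum
  have hfr : ∃ᶠ w in nhdsWithin (0 : ℝ) {0}ᶜ, f w = 0 := by
    have h1 : ∀ᶠ w in nhdsWithin (0 : ℝ) (Set.Ioi 0), f w = 0 := by
      filter_upwards [self_mem_nhdsWithin] with w hw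
      exact (h w hw).tsum_eq
    exact h1.frequently.filter_mono (nhdsWithin_mono _ (fun w hw => ne_of_gt hw))
  have hev := (AnalyticAt.frequently_eq_iff_eventually_eq hf.analyticAt
    (analyticAt_const (v := (0 : ℝ)))).mp hfr
  have := (hf.congr hev).eq_zero
  rwa [FormalMultilinearSeries.ofScalars_series_eq_zero] at this

lemma zZ_eq (l : ℕ) : (∑' n, ENNReal.ofReal (zc l n)).toReal =
    2 * π ^ (4 * l) / (Nat.factorial (4 * l + 2)) := by
  have key : ∀ x : ℝ, 0 < x →
      ∑' l, ENNReal.ofReal ((x ^ 4) ^ l) * ∑' n, ENNReal.ofReal (zc l n) =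
      ENNReal.ofReal ((Real.cosh (π * x) - Real.cos (π * x)) / (π * x) ^ 2) := by
    intro x hx
    apply zc_swap _ (by positivity)
    have h1 := zY_hasSum x hx
    rw [← Complex.hasSum_ofReal]
    refine (z_hasSum_congr fun n => ?_).mpr h1
    refine (zY_eq_zc _ (x ^ 4) ?_ (n + 1) n (Nat.lt_succ_self n)).symm
    push_cast
    have hI := Complex.I_sq
    have h4 : (1 + Complex.I) ^ 4 = -4 := by
      have : (1 + Complex.I) ^ 2 = 2 * Complex.I := by linear_combination hI
      calc (1 + Complex.I) ^ 4 = ((1 + Complex.I) ^ 2) ^ 2 := by ring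
        _ = -4 := by rw [this]; linear_combination 4 * hI
    linear_combination (x : ℂ) ^ 4 / 4 * h4
  have hfin : ∀ l, ∑' n, ENNReal.ofReal (zc l n) ≠ ⊤ := by
    intro l
    have h1 := key 1 one_pos
    simp only [one_pow, ENNReal.ofReal_one, one_mul] at h1
    exact ENNReal.ne_top_of_tsum_ne_top (h1 ▸ ENNReal.ofReal_ne_top) l
  have hz : (fun l => (∑' n, ENNReal.ofReal (zc l n)).toReal -
      2 * π ^ (4 * l) / (Nat.factorial (4 * l + 2))) = 0 := by
    apply z_coeff_unique
    intro w hw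
    obtain ⟨x, hx, rfl⟩ : ∃ x : ℝ, 0 < x ∧ x ^ 4 = w :=
      ⟨w ^ ((1 : ℝ) / 4), by positivity, by
        rw [← Real.rpow_natCast, ← Real.rpow_mul hw.le]; norm_num⟩
    have hr := zR_hasSum (π * x) (by positivity)
    have hk := key x hx
    have hsum := ENNReal.hasSum_toReal (hk ▸ ENNReal.ofReal_ne_top)
    have hval := congrArg ENNReal.toReal hk
    have hnn : 0 ≤ (Real.cosh (π * x) - Real.cos (π * x)) / (π * x) ^ 2 :=
      hr.nonneg (fun l => by positivity)
    rw [ENNReal.toReal_ofReal hnn, ENNReal.tsum_toReal_eq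
      (fun l => ENNReal.mul_ne_top ENNReal.ofReal_ne_top (hfin l))] at hval
    rw [hval] at hsum
    have := hsum.sub hr
    rw [sub_self] at this
    refine (z_hasSum_congr fun l => ?_).mpr this
    rw [ENNReal.toReal_mul, ENNReal.toReal_ofReal (by positivity), mul_pow π x, pow_mul x]
    ring
  have := congrFun hz l
  simp only [Pi.zero_apply] at this
  linarith

/-- Validity of a chain. -/
def zValid (l : ℕ) (p : (Fin l → ℕ) × (Fin l → ℕ)) : Prop :=
  (∀ i, p.2 i < p.1 i) ∧ (∀ i j, i < j → p.1 j < p.2 i) ∧ ∀ i, 1 ≤ p.2 i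

lemma zValid_cons (l : ℕ) (P : ℕ → Prop) (hP : ∀ a b, a < b → P b → P a)
    (n m : ℕ) (p q : Fin l → ℕ) :
    (zValid (l + 1) (Fin.cons n p, Fin.cons m q) ∧ ∀ i, P ((Fin.cons n p : Fin (l + 1) → ℕ) i)) ↔
      (P n ∧ m < n ∧ 1 ≤ m) ∧ (zValid l (p, q) ∧ ∀ i, p i < m) := by
  simp only [zValid, Fin.forall_fin_succ, Fin.cons_zero, Fin.cons_succ, Fin.succ_lt_succ_iff,
    lt_irrefl, Fin.succ_pos, Fin.not_lt_zero, true_imp_iff, false_imp_iff, true_and, and_true]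
  constructor
  · rintro ⟨⟨⟨h1, h2⟩, ⟨h3, h4⟩, h5, h6⟩, h7, h8⟩
    exact ⟨⟨h7, h1, h5⟩, ⟨h2, h4, h6⟩, h3⟩
  · rintro ⟨⟨h7, h1, h5⟩, ⟨h2, h4, h6⟩, h3⟩
    exact ⟨⟨⟨h1, h2⟩, ⟨h3, h4⟩, h5, h6⟩, h7, fun i => hP _ _ ((h3 i).trans h1) h7⟩

/-- The weight. -/
noncomputable def zWt (l : ℕ) (p : (Fin l → ℕ) × (Fin l → ℕ)) : ℝ :=
  ∏ i : Fin l, (1 : ℝ) / ((p.1 i : ℝ) ^ 3 * (p.2 i : ℝ))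

open Classical in
lemma z_chain (l : ℕ) (P : ℕ → Prop) (hP : ∀ a b, a < b → P b → P a) (h0 : P 0) :
    ∑' p : (Fin l → ℕ) × (Fin l → ℕ),
      (if zValid l p ∧ ∀ i, P (p.1 i) then ENNReal.ofReal (zWt l p) else 0) =
    ∑' n, if P n then ENNReal.ofReal (zc l n) else 0 := by
  induction l generalizing P with
  | zero =>
    rw [tsum_eq_single (0 : ℕ)]
    · have : ∀ p : (Fin 0 → ℕ) × (Fin 0 → ℕ), zValid 0 p := fun p => by simp [zValid]
      rw [tsum_eq_single default]
      · simp [this, zWt, zc, h0]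
      · intro b hb
        exact absurd (Subsingleton.elim _ _) hb
    · intro n hn
      simp [zc, hn]
  | succ l ih =>
    let e : (ℕ × ℕ) × ((Fin l → ℕ) × (Fin l → ℕ)) ≃ (Fin (l + 1) → ℕ) × (Fin (l + 1) → ℕ) :=
      (Equiv.prodProdProdComm _ _ _ _).trans
        (Equiv.prodCongr (Fin.consEquiv fun _ => ℕ) (Fin.consEquiv fun _ => ℕ))
    have he : ∀ n m p q, e ((n, m), (p, q)) = (Fin.cons n p, Fin.cons m q) := fun _ _ _ _ => rfl
    rw [← e.tsum_eq, ENNReal.tsum_prod', ENNReal.tsum_prod']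
    congr 1
    ext1 n
    have hin : ∀ m, ∑' pq : (Fin l → ℕ) × (Fin l → ℕ),
        (if zValid (l + 1) (e ((n, m), pq)) ∧ ∀ i, P ((e ((n, m), pq)).1 i) then
          ENNReal.ofReal (zWt (l + 1) (e ((n, m), pq))) else 0) =
        if P n ∧ m < n ∧ 1 ≤ m then ENNReal.ofReal (1 / (n : ℝ) ^ 3 * (1 / (m : ℝ) *
          ∑ j ∈ Finset.range m, zc l j)) else 0 := by
      intro m
      have hterm : ∀ pq : (Fin l → ℕ) × (Fin l → ℕ),
        (if zValid (l + 1) (e ((n, m), pq)) ∧ ∀ i, P ((e ((n, m), pq)).1 i) then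
          ENNReal.ofReal (zWt (l + 1) (e ((n, m), pq))) else 0) =
        (if P n ∧ m < n ∧ 1 ≤ m then ENNReal.ofReal (1 / (n : ℝ) ^ 3 * (1 / (m : ℝ))) else 0) *
          (if zValid l pq ∧ ∀ i, pq.1 i < m then ENNReal.ofReal (zWt l pq) else 0) := by
        rintro ⟨p, q⟩
        rw [he]
        simp only [zValid_cons l P hP]
        have hw : zWt (l + 1) (Fin.cons n p, Fin.cons m q) =
            (1 / (n : ℝ) ^ 3 * (1 / (m : ℝ))) * zWt l (p, q) := by
          rw [zWt, Fin.prod_univ_succ]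
          simp only [Fin.cons_zero, Fin.cons_succ, zWt]
          congr 1
          rw [one_div_mul_one_div]
        rw [hw, ENNReal.ofReal_mul (by positivity), ite_and, ite_mul, zero_mul, mul_ite, mul_zero]
      simp_rw [hterm]
      rw [ENNReal.tsum_mul_left]
      by_cases hc : P n ∧ m < n ∧ 1 ≤ m
      · have ihm : ∑' p : (Fin l → ℕ) × (Fin l → ℕ),
            (if zValid l p ∧ ∀ i, p.1 i < m then ENNReal.ofReal (zWt l p) else 0) =
            ∑' n, if n < m then ENNReal.ofReal (zc l n) else 0 := by
          convert ih (fun k => k < m) (fun a b hab hb => hab.trans hb) hc.2.2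
        rw [if_pos hc, if_pos hc, ihm,
          ← mul_assoc, ENNReal.ofReal_mul (p := 1 / (n : ℝ) ^ 3 * (1 / (m : ℝ))) (by positivity),
          ENNReal.ofReal_sum_of_nonneg (fun j _ => zc_nonneg l j),
          tsum_eq_sum (s := Finset.range m)]
        · congr 1
          apply Finset.sum_congr rfl
          intro j hj
          rw [if_pos (Finset.mem_range.mp hj)]
        · intro j hj
          rw [if_neg (by simpa using hj)]
      · rw [if_neg hc, if_neg hc, zero_mul]
    simp_rw [hin]
    by_cases hn : P n
    · rw [if_pos hn, zc, tsum_eq_sum (s := Finset.range n), Finset.mul_sum,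
        ENNReal.ofReal_sum_of_nonneg]
      · apply Finset.sum_congr rfl
        intro m hm
        by_cases hm1 : 1 ≤ m
        · rw [if_pos ⟨hn, Finset.mem_range.mp hm, hm1⟩]
        · rw [if_neg (fun h => hm1 h.2.2)]
          have : m = 0 := by omega
          subst this
          simp
      · intro m _
        exact mul_nonneg (by positivity) (mul_nonneg (by positivity)
          (Finset.sum_nonneg fun j _ => zc_nonneg l j))
      · intro m hm
        rw [if_neg (fun h => hm (Finset.mem_range.mpr h.2.1))]
    · simp [hn]

theorem zetaThreeOneRep_eq (l : ℕ) (hl : 1 ≤ l) :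
    zetaThreeOneRep l = 2 * π ^ (4 * l) / (Nat.factorial (4 * l + 2)) := by
  classical
  rw [← zZ_eq l]
  have h := z_chain l (fun _ => True) (fun _ _ _ _ => trivial) trivial
  simp only [if_true, implies_true, and_true] at h
  rw [← h]
  have h2 : ∑' p : (Fin l → ℕ) × (Fin l → ℕ),
      (if zValid l p then ENNReal.ofReal (zWt l p) else 0) =
      ∑' p : {p | zValid l p}, ENNReal.ofReal (zWt l p) := by
    rw [tsum_subtype {p | zValid l p} (fun p => ENNReal.ofReal (zWt l p))]
    congr 1
  rw [h2, ENNReal.tsum_toReal_eq (fun _ => ENNReal.ofReal_ne_top)]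
  have h3 : ∀ p : (Fin l → ℕ) × (Fin l → ℕ), (ENNReal.ofReal (zWt l p)).toReal = zWt l p :=
    fun p => ENNReal.toReal_ofReal (Finset.prod_nonneg fun i _ => by positivity)
  simp_rw [h3]
  rfl
end

section
/- Define C(z;t) = ∑_{l≥0} Li_{{3}^l}(z) t^{3l}, where Li_{{3}^l}(z) = ∑_{n_1>⋯>n_l≥1} z^{n_1}/(n_1³⋯n_l³). Then for |z| < 1 (and appropriate t), C satisfies the differential equation ((1−z) d/dz)(z d/dz)² C(z;t) = t³ C(z;t). -/
open scoped BigOperators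

/-- The generalized polylogarithm Li_{{3}^l}(z). -/
noncomputable def LiThree : ℕ → ℂ → ℂ
  | 0, _ => 1
  | (l + 1), z =>
      ∑' f : {f : Fin (l + 1) → ℕ // StrictAnti f ∧ ∀ i, 1 ≤ f i},
        z ^ (f.1 0) / ∏ i : Fin (l + 1), ((f.1 i : ℂ)) ^ 3

/-- C(z;t) = ∑_{l ≥ 0} Li_{{3}^l}(z) t^{3l}. -/
noncomputable def Cgen (z t : ℂ) : ℂ := ∑' l : ℕ, LiThree l z * t ^ (3 * l)

namespace CgenAux

open Filter Topology

/-- the weight of an index -/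
noncomputable def X (t : ℂ) (m : ℕ) : ℂ := t ^ 3 / (m : ℂ) ^ 3

/-- the partial products -/
noncomputable def P (t : ℂ) (n : ℕ) : ℂ := ∏ m ∈ Finset.range n, (1 + X t m)

/-- the coefficients -/
noncomputable def A (t : ℂ) (n : ℕ) : ℂ := if n = 0 then 1 else X t n * P t n

/-- the summand over finite sets -/
noncomputable def G (z t : ℂ) (S : Finset ℕ) : ℂ := z ^ (S.sup id) * ∏ m ∈ S, X t m

lemma X_zero (t : ℂ) : X t 0 = 0 := by simp [X]

lemma summable_X (t : ℂ) : Summable fun m => ‖X t m‖ := by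
  have h : Summable fun m : ℕ => ‖t‖ ^ 3 * (1 / (m : ℝ) ^ 3) :=
    (Real.summable_one_div_nat_pow.2 (by norm_num)).mul_left _
  refine h.congr fun m => ?_
  simp [X, div_eq_mul_inv]

lemma P_bound (t : ℂ) : ∃ K : ℝ, ∀ n, ‖P t n‖ ≤ K := by
  refine ⟨Real.exp (∑' m, ‖X t m‖), fun n => ?_⟩
  rw [P, norm_prod]
  calc ∏ m ∈ Finset.range n, ‖1 + X t m‖ ≤ ∏ m ∈ Finset.range n, (1 + ‖X t m‖) := by
        refine Finset.prod_le_prod (fun _ _ => norm_nonneg _) fun m _ => ?_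
        simpa using norm_add_le (1 : ℂ) (X t m)
    _ ≤ Real.exp (∑ m ∈ Finset.range n, ‖X t m‖) :=
        Real.prod_one_add_le_exp_sum _ fun _ => norm_nonneg _
    _ ≤ _ := Real.exp_le_exp.2 ((summable_X t).sum_le_tsum _ fun _ _ => norm_nonneg _)

lemma summable_G (z t : ℂ) (hz : ‖z‖ < 1) : Summable (G z t) := by
  refine Summable.of_norm_bounded
    (summable_finsetProd_of_summable_nonneg (fun _ => norm_nonneg _) (summable_X t)) fun S => ?_
  rw [G, norm_mul, norm_pow, norm_prod]
  exact mul_le_of_le_one_left (Finset.prod_nonneg fun _ _ => norm_nonneg _)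
    (pow_le_one₀ (norm_nonneg _) hz.le)

/-- cube-weighted coefficients -/
lemma cube_A (t : ℂ) (n : ℕ) : (n : ℂ) ^ 3 * A t n = if n = 0 then 0 else t ^ 3 * P t n := by
  rcases eq_or_ne n 0 with rfl | h
  · simp
  · have : (n : ℂ) ≠ 0 := by exact_mod_cast h
    simp only [A, h, if_false, X]
    field_simp

lemma A_bound (t : ℂ) : ∃ K : ℝ, ∀ k ≤ 2, ∀ n : ℕ, ‖(n : ℂ) ^ k * A t n‖ ≤ K := by
  obtain ⟨K, hK⟩ := P_bound t
  have hK0 : 0 ≤ K := (norm_nonneg _).trans (hK 0)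
  refine ⟨max 1 (‖t‖ ^ 3 * K), fun k hk n => ?_⟩
  rcases eq_or_ne n 0 with rfl | h
  · refine le_trans ?_ (le_max_left _ _)
    rcases eq_or_ne k 0 with rfl | h
    · simp [A]
    · simp [h]
  · refine le_trans ?_ (le_max_right _ _)
    have h1 : (1 : ℝ) ≤ n := by exact_mod_cast Nat.one_le_iff_ne_zero.2 h
    calc ‖(n : ℂ) ^ k * A t n‖ ≤ ‖(n : ℂ) ^ 3 * A t n‖ := by
          rw [norm_mul, norm_mul, norm_pow, norm_pow, Complex.norm_natCast]
          gcongr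
          omega
      _ = ‖t‖ ^ 3 * ‖P t n‖ := by rw [cube_A, if_neg h, norm_mul, norm_pow]
      _ ≤ _ := by gcongr; exact hK n

lemma summable_bdd {b : ℕ → ℂ} {K : ℝ} (hb : ∀ n, ‖b n‖ ≤ K) {y : ℂ} (hy : ‖y‖ < 1) :
    Summable fun n => b n * y ^ n := by
  refine Summable.of_norm_bounded
    ((summable_geometric_of_lt_one (norm_nonneg y) hy).mul_left K) fun n => ?_
  rw [norm_mul, norm_pow]
  gcongr
  exact hb n

lemma hasDerivAt_series {b : ℕ → ℂ} {K : ℝ} (hb : ∀ n, ‖b n‖ ≤ K) {y : ℂ} (hy : ‖y‖ < 1) :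
    HasDerivAt (fun w => ∑' n, b n * w ^ n) (∑' n, b n * (n * y ^ (n - 1))) y := by
  obtain ⟨r, hyr, hr1⟩ := exists_between hy
  have hr0 : 0 < r := (norm_nonneg y).trans_lt hyr
  have hs : Summable fun n : ℕ => K * ((n : ℝ) * r ^ (n - 1)) := by
    have h := (summable_pow_mul_geometric_of_norm_lt_one 1
      (r := r) (by rwa [Real.norm_of_nonneg hr0.le])).mul_left (K * r⁻¹)
    refine h.congr fun n => ?_
    rcases n with _ | n
    · simp
    · simp only [Nat.add_sub_cancel, pow_succ]
      field_simp
  refine hasDerivAt_tsum_of_isPreconnected (t := Metric.ball 0 r) (y₀ := y) hs Metric.isOpen_ball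
    (convex_ball (0 : ℂ) r).isPreconnected (fun n w _ => (hasDerivAt_pow n w).const_mul (b n))
    (fun n w hw => ?_) (by simpa using hyr) (summable_bdd hb hy) (by simpa using hyr)
  have hw' : ‖w‖ ≤ r := by simpa using (Metric.mem_ball.1 hw).le
  rw [norm_mul, norm_mul, norm_pow, Complex.norm_natCast]
  have := (norm_nonneg _).trans (hb 0)
  gcongr
  exact hb n

lemma deriv_of_eq {F : ℂ → ℂ} {b : ℕ → ℂ} {K : ℝ} (hb : ∀ n, ‖b n‖ ≤ K)
    (hF : ∀ w, ‖w‖ < 1 → F w = ∑' n, b n * w ^ n) {y : ℂ} (hy : ‖y‖ < 1) :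
    deriv F y = ∑' n, b n * (n * y ^ (n - 1)) := by
  have h : F =ᶠ[𝓝 y] fun w => ∑' n, b n * w ^ n := by
    filter_upwards [Metric.isOpen_ball.mem_nhds (x := y) (s := Metric.ball 0 1) (by simpa using hy)]
      with w hw
    exact hF w (by simpa using hw)
  rw [h.deriv_eq]
  exact (hasDerivAt_series hb hy).deriv

lemma mul_deriv_of_eq {F : ℂ → ℂ} {b : ℕ → ℂ} {K : ℝ} (hb : ∀ n, ‖b n‖ ≤ K)
    (hF : ∀ w, ‖w‖ < 1 → F w = ∑' n, b n * w ^ n) {y : ℂ} (hy : ‖y‖ < 1) :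
    y * deriv F y = ∑' n, (n * b n) * y ^ n := by
  rw [deriv_of_eq hb hF hy, ← tsum_mul_left]
  refine tsum_congr fun n => ?_
  rcases n with _ | n
  · simp
  · simp only [Nat.add_sub_cancel, pow_succ]
    ring

lemma sum_powerset (z t : ℂ) (N : ℕ) :
    ∑ S ∈ (Finset.range (N + 1)).powerset, G z t S = ∑ n ∈ Finset.range (N + 1), A t n * z ^ n := by
  have key : ∀ N, ∑ S ∈ (Finset.range (N + 1)).powerset, G z t S
      = ∑ S ∈ (Finset.range N).powerset, G z t S + X t N * P t N * z ^ N := by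
    intro N
    rw [Finset.range_add_one, Finset.sum_powerset_insert Finset.notMem_range_self]
    congr 1
    rw [P, Finset.prod_one_add, Finset.mul_sum, Finset.sum_mul]
    refine Finset.sum_congr rfl fun S hS => ?_
    have hS' := Finset.mem_powerset.1 hS
    have hN : N ∉ S := fun h => Finset.notMem_range_self (hS' h)
    have hsup : (insert N S).sup id = N := by
      rw [Finset.sup_insert, id]
      refine sup_eq_left.2 (Finset.sup_le fun m hm => ?_)
      exact (Finset.mem_range.1 (hS' hm)).le
    rw [G, hsup, Finset.prod_insert hN]
    ring
  induction N with
  | zero =>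
    rw [key]
    simp [X_zero, A, G]
  | succ N ih =>
    rw [key, ih, Finset.sum_range_succ _ (N + 1)]
    simp [A]

lemma tsum_G (z t : ℂ) (hz : ‖z‖ < 1) : ∑' S, G z t S = ∑' n, A t n * z ^ n := by
  obtain ⟨K, hK⟩ := A_bound t
  have h1 := (summable_bdd (b := A t) (fun n => by simpa using hK 0 (by norm_num) n)
    hz).hasSum.tendsto_sum_nat
  have h2 : Tendsto (fun N => ∑ S ∈ (Finset.range N).powerset, G z t S) atTop
      (𝓝 (∑' S, G z t S)) := by
    have h := (summable_G z t hz).hasSum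
    exact h.comp (tendsto_finset_powerset_atTop_atTop.comp tendsto_finset_range)
  refine tendsto_nhds_unique h2 (h1.congr' ?_)
  filter_upwards [eventually_ge_atTop 1] with N hN
  obtain ⟨M, rfl⟩ := Nat.exists_eq_add_of_le' hN
  exact (sum_powerset z t M).symm

lemma LiThree_eq (z t : ℂ) (l : ℕ) :
    LiThree l z * t ^ (3 * l) = ∑' S : {S : Finset ℕ // S.card = l}, G z t S.1 := by
  rcases l with _ | l
  · rw [tsum_eq_single ⟨∅, rfl⟩]
    · simp [LiThree, G]
    · rintro ⟨S, hS⟩ h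
      exact absurd (Subtype.ext (Finset.card_eq_zero.1 hS)) h
  · rw [LiThree, ← tsum_mul_right]
    let φ : {f : Fin (l + 1) → ℕ // StrictAnti f ∧ ∀ i, 1 ≤ f i} →
        {S : Finset ℕ // S.card = l + 1} := fun f =>
      ⟨Finset.univ.image f.1, by
        rw [Finset.card_image_of_injective _ f.2.1.injective]; simp⟩
    have hφ : Function.Injective φ := by
      intro f g h
      have h' : Finset.univ.image f.1 = Finset.univ.image g.1 := congrArg Subtype.val h
      have h'' := congrArg (fun S : Finset ℕ => (S : Set ℕ)) h'
      simp only [Finset.coe_image, Finset.coe_univ, Set.image_univ] at h''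
      exact Subtype.ext ((f.2.1.range_inj g.2.1).1 h'')
    rw [← hφ.tsum_eq (f := fun S : {S : Finset ℕ // S.card = l + 1} => G z t S.1)]
    · refine tsum_congr fun f => ?_
      have hsup : (Finset.univ.image f.1).sup id = f.1 0 := by
        refine le_antisymm (Finset.sup_le fun m hm => ?_)
          (Finset.le_sup (f := id) (Finset.mem_image_of_mem f.1 (Finset.mem_univ 0)))
        obtain ⟨i, -, rfl⟩ := Finset.mem_image.1 hm
        exact f.2.1.antitone (Fin.zero_le i)
      simp only [φ]
      rw [G, hsup, Finset.prod_image f.2.1.injective.injOn]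
      simp only [X, Finset.prod_div_distrib, Finset.prod_const, Finset.card_univ, Fintype.card_fin]
      rw [pow_mul]
      ring
    · rintro ⟨S, hS⟩ hne
      have h0 : 0 ∉ S := by
        intro h0
        refine hne ?_
        simp only [G]
        rw [Finset.prod_eq_zero h0 (X_zero t), mul_zero]
      refine ⟨⟨fun i => S.orderEmbOfFin hS (Fin.rev i), ?_, ?_⟩, ?_⟩
      · intro i j hij
        exact (S.orderEmbOfFin hS).strictMono (Fin.rev_lt_rev.2 hij)
      · intro i
        have := S.orderEmbOfFin_mem hS (Fin.rev i)
        exact Nat.one_le_iff_ne_zero.2 fun h => h0 (h ▸ this)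
      · refine Subtype.ext ?_
        simp only [φ]
        ext m
        have hr := congrArg (fun T : Set ℕ => m ∈ T) (S.range_orderEmbOfFin hS)
        simp only [Set.mem_range, Finset.mem_coe, eq_iff_iff] at hr
        rw [← hr]
        simp only [Finset.mem_image, Finset.mem_univ, true_and]
        exact ⟨fun ⟨i, hi⟩ => ⟨_, hi⟩, fun ⟨i, hi⟩ => ⟨Fin.rev i, by rw [Fin.rev_rev]; exact hi⟩⟩

lemma Cgen_eq (z t : ℂ) (hz : ‖z‖ < 1) : Cgen z t = ∑' n, A t n * z ^ n := by
  rw [← tsum_G z t hz, Cgen]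
  simp_rw [LiThree_eq]
  rw [← (Equiv.sigmaFiberEquiv (Finset.card : Finset ℕ → ℕ)).tsum_eq (G z t)]
  rw [Summable.tsum_sigma]
  · rfl
  · exact (summable_G z t hz).comp_injective
      (Equiv.sigmaFiberEquiv (Finset.card : Finset ℕ → ℕ)).injective

end CgenAux

open CgenAux in
theorem Cgen_diffEq (z t : ℂ) (hz : ‖z‖ < 1) (ht : ‖t‖ < 1) :
    (1 - z) * deriv (fun w => w * deriv (fun w => w * deriv (fun w => Cgen w t) w) w) z
      = t ^ 3 * Cgen z t := by
  obtain ⟨K, hK⟩ := A_bound t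
  have b0 : ∀ n, ‖A t n‖ ≤ K := fun n => by simpa using hK 0 (by norm_num) n
  have b1 : ∀ n : ℕ, ‖(n : ℂ) * A t n‖ ≤ K := fun n => by simpa using hK 1 (by norm_num) n
  have b2 : ∀ n : ℕ, ‖(n : ℂ) * (n * A t n)‖ ≤ K := fun n => by
    simpa [pow_two, mul_assoc] using hK 2 (by norm_num) n
  have h1 := fun w (hw : ‖w‖ < 1) => mul_deriv_of_eq b0 (F := fun w => Cgen w t)
    (fun w hw => Cgen_eq w t hw) hw
  have h2 := fun w (hw : ‖w‖ < 1) => mul_deriv_of_eq b1 h1 hw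
  rw [deriv_of_eq b2 h2 hz, Cgen_eq z t hz]
  obtain ⟨L, hL⟩ := P_bound t
  have s1 : Summable fun n => P t (n + 1) * z ^ n := summable_bdd (fun n => hL (n + 1)) hz
  have e1 : ∑' n : ℕ, (n : ℂ) * (n * A t n) * (n * z ^ (n - 1))
      = t ^ 3 * ∑' n, P t (n + 1) * z ^ n := by
    have hterm : ∀ n : ℕ, ((n + 1 : ℕ) : ℂ) * ((n + 1 : ℕ) * A t (n + 1))
        * ((n + 1 : ℕ) * z ^ (n + 1 - 1)) = t ^ 3 * (P t (n + 1) * z ^ n) := by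
      intro n
      have := cube_A t (n + 1)
      rw [if_neg (Nat.succ_ne_zero n)] at this
      rw [Nat.add_sub_cancel, ← mul_assoc (t ^ 3), ← this]
      ring
    rw [tsum_eq_zero_add']
    · simp_rw [hterm]
      rw [tsum_mul_left]
      simp
    · simp_rw [hterm]
      exact s1.mul_left _
  rw [e1, mul_left_comm]
  congr 1
  have s0 : Summable fun n => P t (n + 1) * z ^ (n + 1) :=
    (s1.mul_left z).congr fun n => by ring
  have s2 : Summable fun n => P t (n + 2) * z ^ (n + 1) :=
    (summable_nat_add_iff 1 (f := fun n => P t (n + 1) * z ^ n)).2 s1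
  have sA := summable_bdd b0 hz
  have e2 : z * ∑' n, P t (n + 1) * z ^ n = ∑' n, P t (n + 1) * z ^ (n + 1) := by
    rw [← tsum_mul_left]
    exact tsum_congr fun n => by ring
  rw [sub_mul, one_mul, e2, sA.tsum_eq_zero_add, s1.tsum_eq_zero_add, add_sub_assoc,
    ← s2.tsum_sub s0]
  congr 1
  · simp [P, A, X_zero]
  · refine tsum_congr fun n => ?_
    have : P t (n + 2) = P t (n + 1) * (1 + X t (n + 1)) := Finset.prod_range_succ _ _
    rw [this, A, if_neg (Nat.succ_ne_zero n)]
    ring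
end

section
/- Define the alternating multiple polylogarithm Li_{{2̄,1}^l}(z) = ∑_{n_1>m_1>⋯>n_l>m_l≥1} z^{n_1}(−1)^{n_1+⋯+n_l}/(n_1²m_1⋯n_l²m_l). Then for l ≥ 1 and |z| < 1: ((1+z) d/dz)²(z d/dz) Li_{{2̄,1}^l}(z) = Li_{{2̄,1}^{l−1}}(−z). -/
open scoped BigOperators

/-- The alternating multiple polylogarithm Li_{{2̄,1}^l}(z). -/
noncomputable def LiAltTwoOne : ℕ → ℂ → ℂ
  | 0, _ => 1
  | (l + 1), z =>
      ∑' p : {p : (Fin (l + 1) → ℕ) × (Fin (l + 1) → ℕ) //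
          (∀ i, p.2 i < p.1 i) ∧ (∀ i j, i < j → p.1 j < p.2 i) ∧ ∀ i, 1 ≤ p.2 i},
        z ^ (p.1.1 0) * (-1 : ℂ) ^ (∑ i : Fin (l + 1), p.1.1 i)
          / ∏ i : Fin (l + 1), ((p.1.1 i : ℂ) ^ 2 * (p.1.2 i : ℂ))

/-- Index condition. -/
def LiCond (l : ℕ) (p : (Fin l → ℕ) × (Fin l → ℕ)) : Prop :=
  (∀ i, p.2 i < p.1 i) ∧ (∀ i j, i < j → p.1 j < p.2 i) ∧ ∀ i, 1 ≤ p.2 i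

/-- Truncated index set. -/
noncomputable def LiT (l N : ℕ) : Finset ((Fin l → ℕ) × (Fin l → ℕ)) := by
  classical
  exact ((Fintype.piFinset (fun _ => Finset.range N)) ×ˢ
    (Fintype.piFinset (fun _ => Finset.range N))).filter (LiCond l)

lemma mem_LiT (l N : ℕ) (p) : p ∈ LiT l N ↔ LiCond l p ∧ ∀ i, p.1 i < N := by
  classical
  unfold LiT
  simp only [Finset.mem_filter, Finset.mem_product, Fintype.mem_piFinset, Finset.mem_range]
  constructor
  · rintro ⟨⟨h1, h2⟩, h3⟩
    exact ⟨h3, h1⟩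
  · rintro ⟨h3, h1⟩
    exact ⟨⟨h1, fun i => (h3.1 i).trans (h1 i)⟩, h3⟩

/-- Coefficients. -/
noncomputable def LiC {K : Type} [Field K] (s : K) : ℕ → ℕ → K
  | 0, n => if n = 0 then 1 else 0
  | (l + 1), n => s ^ n / (n : K) ^ 2 *
      ∑ m ∈ Finset.Ico 1 n, (1 / (m : K)) * ∑ k ∈ Finset.range m, LiC s l k

/-- Summand. -/
noncomputable def LiG {K : Type} [Field K] (s : K) (l : ℕ)
    (p : (Fin l → ℕ) × (Fin l → ℕ)) : K :=
  s ^ (∑ i, p.1 i) / ∏ i, ((p.1 i : K) ^ 2 * (p.2 i : K))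

lemma LiT_step {K : Type} [Field K] (s : K) (l : ℕ) (w : ℕ → K) (N : ℕ)
    (ih : ∀ m, 1 ≤ m → ∑ p ∈ LiT l m, LiG s l p = ∑ k ∈ Finset.range m, LiC s l k) :
    ∑ p ∈ LiT (l + 1) N, w (p.1 0) * LiG s (l + 1) p
      = ∑ n ∈ Finset.range N, w n * LiC s (l + 1) n := by
  have h : ∀ n, w n * LiC s (l + 1) n = ∑ m ∈ Finset.Ico 1 n, ∑ q ∈ LiT l m,
      w n * (s ^ n / (n : K) ^ 2 * ((1 / (m : K)) * LiG s l q)) := by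
    intro n
    rw [LiC, Finset.mul_sum, Finset.mul_sum]
    refine Finset.sum_congr rfl fun m hm => ?_
    rw [← ih m (Finset.mem_Ico.1 hm).1, Finset.mul_sum, Finset.mul_sum, Finset.mul_sum]
  simp_rw [h, Finset.sum_sigma']
  refine Finset.sum_bij'
    (fun p _ => ⟨p.1 0, p.2 0, (Fin.tail p.1, Fin.tail p.2)⟩)
    (fun x _ => (Fin.cons x.1 x.2.2.1, Fin.cons x.2.1 x.2.2.2)) ?_ ?_ ?_ ?_ ?_
  · rintro ⟨a, b⟩ hp
    rw [mem_LiT] at hp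
    obtain ⟨⟨h1, h2, h3⟩, h4⟩ := hp
    simp only [Finset.mem_sigma, Finset.mem_range, Finset.mem_Ico, mem_LiT]
    exact ⟨h4 0, ⟨h3 0, h1 0⟩, ⟨fun i => h1 _, fun i j hij => h2 _ _ (by simpa using hij),
      fun i => h3 _⟩, fun i => h2 _ _ (Fin.succ_pos i)⟩
  · rintro ⟨n, m, a, b⟩ hp
    simp only [Finset.mem_sigma, Finset.mem_range, Finset.mem_Ico, mem_LiT] at hp
    obtain ⟨h1, ⟨h2, h3⟩, ⟨h4, h5, h6⟩, h7⟩ := hp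
    rw [mem_LiT]
    refine ⟨⟨?_, ?_, ?_⟩, ?_⟩
    · intro i
      refine Fin.cases ?_ (fun i => ?_) i
      · simpa using h3
      · simpa using h4 i
    · intro i j
      refine Fin.cases ?_ (fun i => ?_) i
      · refine Fin.cases ?_ (fun j => ?_) j
        · simp
        · intro _
          simpa using h7 j
      · refine Fin.cases ?_ (fun j => ?_) j
        · simp
        · intro hij
          simpa using h5 i j (by simpa using hij)
    · intro i
      refine Fin.cases ?_ (fun i => ?_) i
      · simpa using h2
      · simpa using h6 i
    · intro i
      refine Fin.cases ?_ (fun i => ?_) i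
      · simpa using h1
      · simpa using (h7 i).trans (h3.trans h1)
  · rintro ⟨a, b⟩ hp
    simp
  · rintro ⟨n, m, a, b⟩ hp
    simp
  · rintro ⟨a, b⟩ hp
    simp only [LiG, Fin.sum_univ_succ, Fin.prod_univ_succ, Fin.tail, pow_add]
    simp only [div_eq_mul_inv, mul_inv, one_mul]
    ring

lemma LiT_sum {K : Type} [Field K] (s : K) (l : ℕ) : ∀ m, 1 ≤ m →
    ∑ p ∈ LiT l m, LiG s l p = ∑ k ∈ Finset.range m, LiC s l k := by
  induction l with
  | zero =>
    intro m hm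
    have h1 : LiT 0 m = Finset.univ := by
      ext p
      simp [mem_LiT, LiCond]
    rw [h1]
    simp [LiG, LiC]
    omega
  | succ l ih =>
    intro m hm
    simpa using LiT_step s l (fun _ => 1) m ih

/-- Polynomially bounded sequences. -/
def PB (a : ℕ → ℂ) : Prop := ∃ (C : ℝ) (k : ℕ), ∀ n, ‖a n‖ ≤ C * ((n : ℝ) + 1) ^ k

lemma LiC_bound (l : ℕ) : ∀ n, 0 ≤ LiC (1 : ℝ) l n ∧ LiC (1 : ℝ) l n ≤ ((n : ℝ) + 1) ^ (2 * l) := by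
  induction l with
  | zero =>
    intro n
    simp only [LiC]
    split_ifs <;> simp
  | succ l ih =>
    intro n
    have hB : ∀ m, 0 ≤ ∑ k ∈ Finset.range m, LiC (1 : ℝ) l k :=
      fun m => Finset.sum_nonneg fun k _ => (ih k).1
    constructor
    · rw [LiC]
      exact mul_nonneg (by positivity)
        (Finset.sum_nonneg fun m _ => mul_nonneg (by positivity) (hB m))
    · have hB2 : ∀ m, m ≤ n → ∑ k ∈ Finset.range m, LiC (1 : ℝ) l k ≤ ((n : ℝ) + 1) ^ (2 * l + 1) := by
        intro m hm
        have hm' : (m : ℝ) ≤ n + 1 := by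
          have : (m : ℝ) ≤ n := by exact_mod_cast hm
          linarith
        calc _ ≤ ∑ k ∈ Finset.range m, ((n : ℝ) + 1) ^ (2 * l) := by
              refine Finset.sum_le_sum fun k hk => (ih k).2.trans ?_
              have : (k : ℝ) ≤ n := by
                have := Finset.mem_range.1 hk
                exact_mod_cast (by omega : k ≤ n)
              gcongr
          _ = m * ((n : ℝ) + 1) ^ (2 * l) := by simp
          _ ≤ (n + 1) * ((n : ℝ) + 1) ^ (2 * l) := by gcongr
          _ = _ := by ring
      have h1 : ∑ m ∈ Finset.Ico 1 n, (1 / (m : ℝ)) * ∑ k ∈ Finset.range m, LiC (1 : ℝ) l k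
          ≤ ((n : ℝ) + 1) ^ (2 * (l + 1)) := by
        calc _ ≤ ∑ m ∈ Finset.Ico 1 n, ((n : ℝ) + 1) ^ (2 * l + 1) := by
              refine Finset.sum_le_sum fun m hm => ?_
              rw [Finset.mem_Ico] at hm
              have hm1 : (1 : ℝ) ≤ m := by exact_mod_cast hm.1
              have h2 : 1 / (m : ℝ) ≤ 1 := by
                rw [div_le_one (by linarith)]; exact hm1
              calc _ ≤ 1 * ∑ k ∈ Finset.range m, LiC (1 : ℝ) l k :=
                    mul_le_mul_of_nonneg_right h2 (hB m)
                _ ≤ _ := by rw [one_mul]; exact hB2 m hm.2.le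
          _ = ((n - 1 : ℕ) : ℝ) * ((n : ℝ) + 1) ^ (2 * l + 1) := by simp
          _ ≤ (n + 1) * ((n : ℝ) + 1) ^ (2 * l + 1) := by
              have : ((n - 1 : ℕ) : ℝ) ≤ n := by exact_mod_cast Nat.sub_le n 1
              gcongr
              linarith
          _ = _ := by ring
      have h0 : 0 ≤ ∑ m ∈ Finset.Ico 1 n, (1 / (m : ℝ)) * ∑ k ∈ Finset.range m, LiC (1 : ℝ) l k :=
        Finset.sum_nonneg fun m _ => mul_nonneg (by positivity) (hB m)
      rw [LiC]
      have h3 : (1 : ℝ) ^ n / (n : ℝ) ^ 2 ≤ 1 := by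
        rcases Nat.eq_zero_or_pos n with h | h
        · subst h; simp
        · have : (1 : ℝ) ≤ n := by exact_mod_cast h
          rw [one_pow, div_le_one (by positivity)]
          nlinarith
      calc _ ≤ 1 * _ := mul_le_mul_of_nonneg_right h3 h0
        _ ≤ _ := by rw [one_mul]; exact h1

lemma LiC_norm (l : ℕ) : ∀ n, ‖LiC (-1 : ℂ) l n‖ ≤ LiC (1 : ℝ) l n := by
  induction l with
  | zero =>
    intro n
    simp only [LiC]
    split_ifs <;> simp
  | succ l ih =>
    intro n
    rw [LiC, LiC, norm_mul]
    have h1 : ‖(-1 : ℂ) ^ n / (n : ℂ) ^ 2‖ = (1 : ℝ) ^ n / (n : ℝ) ^ 2 := by simp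
    rw [h1]
    refine mul_le_mul_of_nonneg_left ?_ (by positivity)
    refine (norm_sum_le _ _).trans (Finset.sum_le_sum fun m _ => ?_)
    rw [norm_mul]
    have h2 : ‖1 / (m : ℂ)‖ = 1 / (m : ℝ) := by simp
    rw [h2]
    refine mul_le_mul_of_nonneg_left ?_ (by positivity)
    exact (norm_sum_le _ _).trans (Finset.sum_le_sum fun k _ => ih k)

lemma LiC_PB (l : ℕ) : PB (LiC (-1 : ℂ) l) :=
  ⟨1, 2 * l, fun n => by rw [one_mul]; exact (LiC_norm l n).trans (LiC_bound l n).2⟩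

lemma summable_poly (k : ℕ) (r : ℝ) (h0 : 0 ≤ r) (h1 : r < 1) :
    Summable fun n : ℕ => ((n : ℝ) + 1) ^ k * r ^ n := by
  have h := summable_pow_mul_geometric_of_norm_lt_one (R := ℝ) k (r := r)
    (by rw [Real.norm_eq_abs, abs_of_nonneg h0]; exact h1)
  have h' := (h.mul_left (2 ^ k)).add
    (summable_geometric_of_lt_one h0 h1)
  refine Summable.of_nonneg_of_le (fun n => by positivity) (fun n => ?_) h'
  rcases Nat.eq_zero_or_pos n with h | h
  · subst h
    have : (0:ℝ) ≤ 2 ^ k * (0 ^ k) := by positivity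
    simpa using this
  · have : (1 : ℝ) ≤ n := by exact_mod_cast h
    have h2 : ((n : ℝ) + 1) ^ k ≤ 2 ^ k * (n : ℝ) ^ k := by
      rw [← mul_pow]
      gcongr
      linarith
    have h3 := mul_le_mul_of_nonneg_right h2 (pow_nonneg h0 n)
    have h4 : 0 ≤ r ^ n := by positivity
    linarith

lemma PB.summable_norm {a : ℕ → ℂ} (h : PB a) {r : ℝ} (h0 : 0 ≤ r) (h1 : r < 1) :
    Summable fun n => ‖a n‖ * r ^ n := by
  obtain ⟨C, k, hC⟩ := h
  refine Summable.of_nonneg_of_le (fun n => by positivity) (fun n => ?_)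
    ((summable_poly k r h0 h1).mul_left C)
  rw [← mul_assoc]
  exact mul_le_mul_of_nonneg_right (hC n) (by positivity)

lemma PB.summable {a : ℕ → ℂ} (h : PB a) {z : ℂ} (hz : ‖z‖ < 1) :
    Summable fun n => a n * z ^ n := by
  refine Summable.of_norm ?_
  simpa using h.summable_norm (norm_nonneg z) hz

/-- Power series. -/
noncomputable def PS (a : ℕ → ℂ) (z : ℂ) : ℂ := ∑' n, a n * z ^ n

lemma Li_eq_PS (l : ℕ) (z : ℂ) (hz : ‖z‖ < 1) :
    LiAltTwoOne l z = PS (LiC (-1 : ℂ) l) z := by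
  classical
  cases l with
  | zero =>
    rw [PS, tsum_eq_single 0]
    · simp [LiAltTwoOne, LiC]
    · intro n hn
      simp [LiC, hn]
  | succ l =>
    let f : {p // LiCond (l + 1) p} → ℂ := fun p => z ^ (p.1.1 0) * LiG (-1 : ℂ) (l + 1) p.1
    have hL : LiAltTwoOne (l + 1) z = ∑' p, f p := by
      rw [LiAltTwoOne]
      refine tsum_congr fun p => ?_
      simp only [f, LiG, mul_div_assoc]
    let S : ℕ → Finset {p // LiCond (l + 1) p} := fun N => (LiT (l + 1) N).subtype _
    have hmem : ∀ N p, p ∈ S N ↔ ∀ i, p.1.1 i < N := by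
      intro N p
      simp only [S, Finset.mem_subtype, mem_LiT]
      exact ⟨fun h => h.2, fun h => ⟨p.2, h⟩⟩
    have hSmono : Monotone S := by
      intro M N hMN p hp
      rw [hmem] at *
      exact fun i => (hp i).trans_le hMN
    have hS : Filter.Tendsto S Filter.atTop Filter.atTop := by
      refine Filter.tendsto_atTop_finset_of_monotone hSmono fun p => ⟨(∑ i, p.1.1 i) + 1, ?_⟩
      rw [hmem]
      intro i
      exact Nat.lt_succ_of_le (Finset.single_le_sum (f := fun i => p.1.1 i) (fun _ _ => Nat.zero_le _) (Finset.mem_univ i))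
    have hsum : ∀ {A : Type} [AddCommMonoid A] (g : _ → A) N,
        ∑ p ∈ S N, g p.1 = ∑ p ∈ LiT (l + 1) N, g p := by
      intro A _ g N
      exact Finset.sum_subtype_of_mem g fun p hp => ((mem_LiT _ _ _).1 hp).1
    have hnorm : ∀ p, ‖f p‖ = ‖z‖ ^ (p.1.1 0) * LiG (1 : ℝ) (l + 1) p.1 := by
      intro p
      simp [f, LiG]
    have hsn := summable_poly (2 * (l + 1)) ‖z‖ (norm_nonneg z) hz
    have hf : Summable f := by
      refine Summable.of_norm ?_
      refine summable_of_sum_le (c := ∑' n : ℕ, ((n : ℝ) + 1) ^ (2 * (l + 1)) * ‖z‖ ^ n)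
        (fun _ => norm_nonneg _) fun u => ?_
      obtain ⟨N, hN⟩ := (hS.eventually (Filter.eventually_ge_atTop u)).exists
      calc _ ≤ ∑ p ∈ S N, ‖f p‖ :=
            Finset.sum_le_sum_of_subset_of_nonneg hN fun _ _ _ => norm_nonneg _
        _ = ∑ p ∈ LiT (l + 1) N, ‖z‖ ^ (p.1 0) * LiG (1 : ℝ) (l + 1) p := by
            simp_rw [hnorm]
            exact hsum (fun p => ‖z‖ ^ (p.1 0) * LiG (1 : ℝ) (l + 1) p) N
        _ = ∑ n ∈ Finset.range N, ‖z‖ ^ n * LiC (1 : ℝ) (l + 1) n :=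
            LiT_step 1 l (fun n => ‖z‖ ^ n) N (LiT_sum 1 l)
        _ ≤ ∑ n ∈ Finset.range N, ((n : ℝ) + 1) ^ (2 * (l + 1)) * ‖z‖ ^ n := by
            refine Finset.sum_le_sum fun n _ => ?_
            rw [mul_comm]
            exact mul_le_mul_of_nonneg_right (LiC_bound _ n).2 (by positivity)
        _ ≤ _ := hsn.sum_le_tsum _ fun _ _ => by positivity
    have h1 : Filter.Tendsto (fun N => ∑ p ∈ S N, f p) Filter.atTop (nhds (∑' p, f p)) :=
      (show Filter.Tendsto _ _ _ from hf.hasSum).comp hS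
    have h2 := ((LiC_PB (l + 1)).summable hz).hasSum.tendsto_sum_nat
    rw [hL, PS]
    refine tendsto_nhds_unique h1 (h2.congr fun N => ?_)
    rw [hsum (fun p => z ^ (p.1 0) * LiG (-1 : ℂ) (l + 1) p) N,
      LiT_step (-1) l (fun n => z ^ n) N (LiT_sum (-1) l)]
    exact Finset.sum_congr rfl fun n _ => mul_comm _ _

/-- coefficients of the derivative -/
def PD (a : ℕ → ℂ) (n : ℕ) : ℂ := ((n : ℂ) + 1) * a (n + 1)
/-- coefficients of z times d/dz -/
def PTh (a : ℕ → ℂ) (n : ℕ) : ℂ := (n : ℂ) * a n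
/-- coefficients of (1+z) times -/
def PM (a : ℕ → ℂ) : ℕ → ℂ
  | 0 => a 0
  | n + 1 => a (n + 1) + a n

lemma PB.C_nonneg {a : ℕ → ℂ} {C : ℝ} {k : ℕ} (h : ∀ n, ‖a n‖ ≤ C * ((n : ℝ) + 1) ^ k) :
    0 ≤ C := by
  have := (norm_nonneg _).trans (h 0)
  simpa using this

lemma PB.th {a : ℕ → ℂ} (h : PB a) : PB (PTh a) := by
  obtain ⟨C, k, hC⟩ := h
  have := PB.C_nonneg hC
  refine ⟨C, k + 1, fun n => ?_⟩
  rw [PTh, norm_mul, Complex.norm_natCast]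
  calc _ ≤ ((n : ℝ) + 1) * (C * ((n : ℝ) + 1) ^ k) := by
        gcongr
        · linarith
        · exact hC n
    _ = _ := by ring

lemma PB.shift {a : ℕ → ℂ} (h : PB a) : PB (fun n => a (n + 1)) := by
  obtain ⟨C, k, hC⟩ := h
  have := PB.C_nonneg hC
  refine ⟨C * 2 ^ k, k, fun n => (hC _).trans ?_⟩
  rw [mul_assoc, ← mul_pow]
  push_cast
  gcongr
  have : (0 : ℝ) ≤ n := by positivity
  linarith

lemma PB.d {a : ℕ → ℂ} (h : PB a) : PB (PD a) := by
  have := h.th.shift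
  simpa [PTh, PD, PB] using this

lemma PB.m {a : ℕ → ℂ} (h : PB a) : PB (PM a) := by
  obtain ⟨C, k, hC⟩ := h
  have h0 := PB.C_nonneg hC
  refine ⟨2 * C, k, fun n => ?_⟩
  cases n with
  | zero =>
    have := hC 0
    simp [PM] at *
    linarith
  | succ n =>
    have h1 := hC (n + 1)
    have h2 := hC n
    have h3 : C * ((n : ℝ) + 1) ^ k ≤ C * (((n + 1 : ℕ) : ℝ) + 1) ^ k := by
      push_cast
      gcongr
      linarith
    have := norm_add_le (a (n + 1)) (a n)
    rw [PM]
    linarith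

lemma PS_hasDerivAt {a : ℕ → ℂ} (h : PB a) {z : ℂ} (hz : ‖z‖ < 1) :
    HasDerivAt (PS a) (PS (PD a) z) z := by
  obtain ⟨r, hr1, hr2⟩ := exists_between hz
  have hr0 : 0 ≤ r := (norm_nonneg z).trans hr1.le
  have hu : Summable fun n : ℕ => ‖(n : ℂ) * a n‖ * r ^ (n - 1) := by
    rw [← summable_nat_add_iff 1]
    have := h.d.summable_norm hr0 hr2
    simpa [PD] using this
  have key := hasDerivAt_tsum_of_isPreconnected (g := fun n w => a n * w ^ n)
    (g' := fun n w => a n * ((n : ℂ) * w ^ (n - 1))) (t := Metric.ball 0 r) (y₀ := 0) (y := z)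
    hu Metric.isOpen_ball (convex_ball _ _).isPreconnected
    (fun n y _ => (hasDerivAt_pow n y).const_mul (a n)) ?_ ?_ ?_ ?_
  · have e : ∑' n, a n * ((n : ℂ) * z ^ (n - 1)) = PS (PD a) z := by
      rw [PS]
      have hs : Summable fun n => a n * ((n : ℂ) * z ^ (n - 1)) := by
        rw [← summable_nat_add_iff 1]
        refine (h.d.summable hz).congr fun n => ?_
        simp [PD]; ring
      rw [hs.tsum_eq_zero_add]
      simp only [Nat.cast_zero, zero_mul, mul_zero, zero_add]
      refine tsum_congr fun n => ?_
      simp [PD]; ring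
    rw [← e]
    exact key
  · intro n y hy
    have hy' : ‖y‖ ≤ r := by simpa using (Metric.mem_ball.1 hy).le
    rw [← mul_assoc, norm_mul, norm_pow, mul_comm (a n)]
    gcongr
  · simpa using lt_of_le_of_lt (norm_nonneg z) hr1
  · exact h.summable (by simp)
  · simpa using hr1

lemma PS_th {a : ℕ → ℂ} (h : PB a) {z : ℂ} (hz : ‖z‖ < 1) :
    z * PS (PD a) z = PS (PTh a) z := by
  rw [PS, PS, ← tsum_mul_left, (h.th.summable hz).tsum_eq_zero_add]
  simp only [PTh, Nat.cast_zero, zero_mul, zero_add]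
  refine tsum_congr fun n => ?_
  simp [PD]; ring

lemma PS_m {a : ℕ → ℂ} (h : PB a) {z : ℂ} (hz : ‖z‖ < 1) :
    (1 + z) * PS a z = PS (PM a) z := by
  have e : PS (PM a) z = a 0 + ((∑' n, a (n + 1) * z ^ (n + 1)) + ∑' n, z * (a n * z ^ n)) := by
    rw [PS, (h.m.summable hz).tsum_eq_zero_add,
      ← Summable.tsum_add ((summable_nat_add_iff (f := fun n => a n * z ^ n) 1).2 (h.summable hz))
        ((h.summable hz).mul_left z)]
    congr 1
    · simp [PM]
    · refine tsum_congr fun n => ?_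
      simp [PM]; ring
  have e2 : PS a z = a 0 + ∑' n, a (n + 1) * z ^ (n + 1) := by
    rw [PS, (h.summable hz).tsum_eq_zero_add]
    simp
  rw [e, tsum_mul_left, ← add_assoc, ← e2, PS]
  ring

lemma deriv_of_eq {f : ℂ → ℂ} {a : ℕ → ℂ} (h : PB a) (hf : ∀ z, ‖z‖ < 1 → f z = PS a z)
    (z : ℂ) (hz : ‖z‖ < 1) : deriv f z = PS (PD a) z := by
  have : f =ᶠ[nhds z] PS a := by
    have ho : IsOpen {w : ℂ | ‖w‖ < 1} := isOpen_lt continuous_norm continuous_const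
    filter_upwards [ho.mem_nhds hz] with w hw
    exact hf w hw
  rw [this.deriv_eq]
  exact (PS_hasDerivAt h hz).deriv

lemma neg_one_pow_mul_self (n : ℕ) : (-1 : ℂ) ^ n * (-1 : ℂ) ^ n = 1 := by
  rw [← mul_pow]; simp

lemma coeff1 (l n : ℕ) : PD (PTh (LiC (-1 : ℂ) (l + 1))) n = (-1) ^ (n + 1) *
    ∑ m ∈ Finset.Ico 1 (n + 1), (1 / (m : ℂ)) * ∑ k ∈ Finset.range m, LiC (-1) l k := by
  have : (n : ℂ) + 1 ≠ 0 := by exact_mod_cast Nat.succ_ne_zero n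
  simp only [PD, PTh, LiC]
  push_cast
  field_simp

lemma coeff2 (l n : ℕ) : PD (PM (PD (PTh (LiC (-1 : ℂ) (l + 1))))) n = (-1) ^ n *
    ∑ k ∈ Finset.range (n + 1), LiC (-1) l k := by
  have : (n : ℂ) + 1 ≠ 0 := by exact_mod_cast Nat.succ_ne_zero n
  rw [PD, PM, coeff1, coeff1, Finset.sum_Ico_succ_top (by omega : 1 ≤ n + 1)]
  push_cast
  field_simp
  ring

lemma coeff3 (l n : ℕ) : PM (PD (PM (PD (PTh (LiC (-1 : ℂ) (l + 1)))))) n =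
    (-1) ^ n * LiC (-1) l n := by
  cases n with
  | zero => rw [PM, coeff2]; simp
  | succ n =>
    rw [PM, coeff2, coeff2, Finset.sum_range_succ _ (n + 1)]
    ring

theorem LiAltTwoOne_diffEq (l : ℕ) (hl : 1 ≤ l) (z : ℂ) (hz : ‖z‖ < 1) :
    (1 + z) * deriv (fun w => (1 + w) * deriv (fun w => w * deriv (LiAltTwoOne l) w) w) z
      = LiAltTwoOne (l - 1) (-z) := by
  obtain ⟨l, rfl⟩ : ∃ k, l = k + 1 := ⟨l - 1, by omega⟩
  have hc := LiC_PB (l + 1)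
  have h1 : ∀ w, ‖w‖ < 1 → w * deriv (LiAltTwoOne (l + 1)) w = PS (PTh (LiC (-1) (l + 1))) w := by
    intro w hw
    rw [deriv_of_eq hc (Li_eq_PS (l + 1)) w hw, PS_th hc hw]
  have h2 : ∀ w, ‖w‖ < 1 → (1 + w) * deriv (fun w => w * deriv (LiAltTwoOne (l + 1)) w) w
      = PS (PM (PD (PTh (LiC (-1) (l + 1))))) w := by
    intro w hw
    rw [deriv_of_eq hc.th h1 w hw, PS_m hc.th.d hw]
  rw [deriv_of_eq hc.th.d.m h2 z hz, PS_m hc.th.d.m.d hz, Nat.add_sub_cancel,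
    Li_eq_PS l (-z) (by simpa using hz), PS, PS]
  refine tsum_congr fun n => ?_
  rw [coeff3, neg_pow z]
  ring
end

section
/- For l ≥ 1, ζ({2,1}^l) = 8^l · ζ({2̄,1}^l), where ζ({2̄,1}^l) = ∑_{n_1>m_1>⋯>n_l>m_l≥1} (−1)^{n_1+⋯+n_l}/(n_1²m_1⋯n_l²m_l). -/
open scoped BigOperators

/-- ζ({2,1}^l). -/
noncomputable def zetaTwoOneRep (l : ℕ) : ℝ :=
  ∑' p : {p : (Fin l → ℕ) × (Fin l → ℕ) //
      (∀ i, p.2 i < p.1 i) ∧ (∀ i j, i < j → p.1 j < p.2 i) ∧ ∀ i, 1 ≤ p.2 i},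
    ∏ i : Fin l, (1 : ℝ) / ((p.1.1 i : ℝ) ^ 2 * (p.1.2 i : ℝ))

/-- ζ({2̄,1}^l), the alternating analogue with sign (−1)^{n_1+⋯+n_l}. -/
noncomputable def zetaAltTwoOneRep (l : ℕ) : ℝ :=
  ∑' p : {p : (Fin l → ℕ) × (Fin l → ℕ) //
      (∀ i, p.2 i < p.1 i) ∧ (∀ i j, i < j → p.1 j < p.2 i) ∧ ∀ i, 1 ≤ p.2 i},
    (-1 : ℝ) ^ (∑ i : Fin l, p.1.1 i)
      / ∏ i : Fin l, ((p.1.1 i : ℝ) ^ 2 * (p.1.2 i : ℝ))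

namespace ZTO
open Finset Filter Topology

/-- truncated nested sums with all outer indices `< N`. -/
noncomputable def sl (e : ℕ → ℝ) : ℕ → ℕ → ℝ
  | 0, _ => 1
  | l + 1, N => ∑ n ∈ range N, e n / (n : ℝ) ^ 2 * ∑ m ∈ range n, sl e l m / (m : ℝ)

noncomputable def ul (e : ℕ → ℝ) (l n : ℕ) : ℝ := ∑ m ∈ range n, sl e l m / (m : ℝ)

def Chain {l : ℕ} (p : (Fin l → ℕ) × (Fin l → ℕ)) : Prop :=
  (∀ i, p.2 i < p.1 i) ∧ (∀ i j, i < j → p.1 j < p.2 i) ∧ ∀ i, 1 ≤ p.2 i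

lemma chain_cons {l : ℕ} (n m : ℕ) (p q : Fin l → ℕ) :
    Chain ((Fin.cons n p : Fin (l+1) → ℕ), (Fin.cons m q : Fin (l+1) → ℕ)) ↔
      (m < n ∧ 1 ≤ m) ∧ (∀ j, p j < m) ∧ Chain (p, q) := by
  unfold Chain
  constructor
  · rintro ⟨h1, h2, h3⟩
    refine ⟨⟨by simpa using h1 0, by simpa using h3 0⟩, fun j => ?_, fun j => ?_, fun i j hij => ?_, fun j => ?_⟩
    · simpa using h2 0 j.succ (Fin.succ_pos j)
    · simpa using h1 j.succ
    · simpa using h2 i.succ j.succ (by simpa using hij)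
    · simpa using h3 j.succ
  · rintro ⟨⟨h1, h2⟩, h3, h4, h5, h6⟩
    refine ⟨fun j => ?_, fun i j hij => ?_, fun j => ?_⟩
    · refine Fin.cases ?_ (fun j => ?_) j
      · simpa using h1
      · simpa using h4 j
    · revert hij
      refine Fin.cases ?_ (fun j => ?_) j
      · intro h; simp at h
      · refine Fin.cases ?_ (fun i => ?_) i
        · intro _; simpa using h3 j
        · intro h; simpa using h5 i j (by simpa using h)
    · refine Fin.cases ?_ (fun j => ?_) j
      · simpa using h2
      · simpa using h6 j

def box (l N : ℕ) : Finset (Fin l → ℕ) := Fintype.piFinset fun _ => range N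

lemma mem_box {l N : ℕ} {p : Fin l → ℕ} : p ∈ box l N ↔ ∀ i, p i < N := by
  simp [box]

lemma sum_box_succ (l N : ℕ) (g : (Fin (l+1) → ℕ) → ℝ) :
    ∑ p ∈ box (l+1) N, g p = ∑ n ∈ range N, ∑ p ∈ box l N, g (Fin.cons n p) := by
  rw [← Finset.sum_product']
  symm
  refine Finset.sum_bij' (fun x _ => (Fin.cons x.1 x.2 : Fin (l+1) → ℕ)) (fun p _ => (p 0, Fin.tail p)) ?_ ?_ ?_ ?_ ?_
  · rintro ⟨n, p⟩ h
    simp only [mem_product, mem_range, mem_box] at h ⊢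
    intro i
    refine Fin.cases ?_ (fun j => ?_) i
    · simpa using h.1
    · simpa using h.2 j
  · intro p h
    simp only [mem_product, mem_range, mem_box] at h ⊢
    exact ⟨h 0, fun i => h i.succ⟩
  · rintro ⟨n, p⟩ h
    simp
  · intro p h
    simp
  · intro p h; rfl

open Classical in
noncomputable def tm (e : ℕ → ℝ) {l : ℕ} (p : (Fin l → ℕ) × (Fin l → ℕ)) : ℝ :=
  if Chain p then ∏ i, (e (p.1 i) / ((p.1 i : ℝ) ^ 2 * (p.2 i : ℝ))) else 0

lemma tm_cons (e : ℕ → ℝ) {l : ℕ} (n m : ℕ) (p q : Fin l → ℕ) :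
    tm e ((Fin.cons n p : Fin (l+1) → ℕ), (Fin.cons m q : Fin (l+1) → ℕ)) =
      if m < n then (e n / (n : ℝ) ^ 2 * (1 / (m : ℝ)) *
        (if (∀ j, p j < m) then tm e (p, q) else 0)) else 0 := by
  unfold tm
  rw [chain_cons]
  rcases Nat.eq_zero_or_pos m with h | h
  · subst h; simp
  · have h' : 1 ≤ m := h
    by_cases h1 : m < n <;> by_cases h2 : ∀ j, p j < m <;> by_cases h3 : Chain (p, q) <;>
      simp only [h1, h2, h3, h', and_self, and_true, and_false, if_true, if_false, mul_zero, implies_true]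
    rw [Fin.prod_univ_succ]
    simp only [Fin.cons_zero, Fin.cons_succ]
    congr 1
    field_simp

lemma tm_zero_of (e : ℕ → ℝ) {l : ℕ} {m : ℕ} {p q : Fin l → ℕ} (hp : ∀ j, p j < m) (hq : ¬ ∀ j, q j < m) :
    tm e (p, q) = 0 := by
  unfold tm
  rw [if_neg]
  intro h
  exact hq fun j => (h.1 j).trans (hp j)

lemma sum_box_tm (e : ℕ → ℝ) (l : ℕ) : ∀ N, ∑ p ∈ box l N, ∑ q ∈ box l N, tm e (p, q) = sl e l N := by
  induction l with
  | zero =>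
    intro N
    simp [box, sl, tm, Chain]
  | succ l ih =>
    intro N
    rw [sum_box_succ]
    simp only [sl]
    refine Finset.sum_congr rfl fun n hn => ?_
    rw [mem_range] at hn
    have : ∀ p ∈ box l N, ∑ q ∈ box (l+1) N, tm e ((Fin.cons n p : Fin (l+1) → ℕ), q) =
        ∑ m ∈ range N, ∑ q ∈ box l N, tm e ((Fin.cons n p : Fin (l+1) → ℕ), (Fin.cons m q : Fin (l+1) → ℕ)) := by
      intro p _
      rw [sum_box_succ]
    rw [Finset.sum_congr rfl this, Finset.sum_comm, Finset.mul_sum]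
    simp only [tm_cons]
    rw [← Finset.sum_subset (Finset.range_subset_range.2 hn.le)]
    · refine Finset.sum_congr rfl fun m hm => ?_
      rw [mem_range] at hm
      simp only [hm, if_true]
      simp only [← Finset.mul_sum]
      have hr : sl e l m / (m:ℝ) = 1 / (m:ℝ) * ∑ p ∈ box l m, ∑ q ∈ box l m, tm e (p, q) := by
        rw [ih m]; ring
      rw [hr, ← mul_assoc]
      congr 1
      have hsub : box l m ⊆ box l N := by
        intro p hp
        rw [mem_box] at hp ⊢
        exact fun i => (hp i).trans (hm.trans hn)
      rw [← Finset.sum_subset hsub]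
      · refine Finset.sum_congr rfl fun p hp => ?_
        rw [mem_box] at hp
        simp only [hp, implies_true, if_true]
        symm
        refine Finset.sum_subset hsub fun q _ hq => ?_
        rw [mem_box] at hq
        exact tm_zero_of e hp hq
      · intro p _ hp
        rw [mem_box] at hp
        simp [hp]
    · intro m _ hm
      rw [mem_range] at hm
      simp [hm]

lemma sl_nonneg (l N : ℕ) : 0 ≤ sl (fun _ => 1) l N := by
  induction l generalizing N with
  | zero => simp [sl]
  | succ l ih =>
    simp only [sl]
    refine Finset.sum_nonneg fun n _ => mul_nonneg (by positivity) (Finset.sum_nonneg fun m _ => ?_)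
    exact div_nonneg (ih m) (by positivity)

lemma ul_nonneg (l N : ℕ) : 0 ≤ ul (fun _ => 1) l N :=
  Finset.sum_nonneg fun m _ => div_nonneg (sl_nonneg l m) (by positivity)

lemma sl_succ (e : ℕ → ℝ) (l N : ℕ) : sl e (l+1) (N+1) = sl e (l+1) N + e N / (N:ℝ)^2 * ul e l N := by
  simp only [sl, ul, Finset.sum_range_succ]

lemma ul_succ (e : ℕ → ℝ) (l N : ℕ) : ul e l (N+1) = ul e l N + sl e l N / (N:ℝ) := by
  simp only [ul, Finset.sum_range_succ]

lemma sl_mono (l : ℕ) : Monotone (sl (fun _ => 1) l) := by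
  cases l with
  | zero => intro a b _; simp [sl]
  | succ l =>
    refine monotone_nat_of_le_succ fun N => ?_
    rw [sl_succ]
    have := ul_nonneg l N
    have : 0 ≤ 1 / (N:ℝ)^2 * ul (fun _ => 1) l N := by positivity
    linarith

/-- Recursive generating sequences. -/
noncomputable def ab (e : ℕ → ℝ) (w : ℝ) : ℕ → ℝ × ℝ
  | 0 => (1, 0)
  | N + 1 => ((ab e w N).1 + w * (e (N+1) / ((N:ℝ)+1)^2 * (ab e w N).2),
              (ab e w N).2 + (ab e w N).1 / ((N:ℝ)+1))

lemma hasSum_ab (e : ℕ → ℝ) (w : ℝ) (N : ℕ) :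
    HasSum (fun l => w ^ l * sl e l (N+1)) (ab e w N).1 ∧
    HasSum (fun l => w ^ l * ul e l (N+1)) (ab e w N).2 := by
  induction N with
  | zero =>
    constructor
    · have : (fun l => w ^ l * sl e l (0+1)) = fun l => if l = 0 then 1 else 0 := by
        funext l
        cases l with
        | zero => simp [sl]
        | succ l => simp [sl]
      rw [this]
      simpa [ab] using hasSum_ite_eq (0:ℕ) (1:ℝ)
    · have : (fun l => w ^ l * ul e l (0+1)) = fun l => 0 := by
        funext l; simp [ul]
      rw [this]
      simp [ab]
  | succ N ih =>
    obtain ⟨h1, h2⟩ := ih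
    constructor
    · have h3 : HasSum (fun l => w ^ (l+1) * sl e (l+1) (N+1)) ((ab e w N).1 - 1) := by
        have := (hasSum_nat_add_iff' 1).2 h1
        simpa [sl] using this
      have h4 := h3.add (h2.mul_left (w * (e (N+1) / ((N:ℝ)+1)^2)))
      have h5 : HasSum (fun l => w ^ (l+1) * sl e (l+1) (N+1+1)) ((ab e w (N+1)).1 - 1) := by
        convert h4 using 1
        · funext l
          rw [sl_succ]; push_cast; ring
        · simp only [ab]; ring
      refine (hasSum_nat_add_iff' 1).1 ?_
      simpa [sl] using h5
    · convert h2.add (h1.mul_left (1/((N:ℝ)+1))) using 1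
      · funext l
        rw [ul_succ]; push_cast; ring
      · simp only [ab]; ring

lemma abs_sl_le {e : ℕ → ℝ} (he : ∀ n, |e n| ≤ 1) (l N : ℕ) : |sl e l N| ≤ sl (fun _ => 1) l N := by
  induction l generalizing N with
  | zero => simp [sl]
  | succ l ih =>
    simp only [sl]
    refine (Finset.abs_sum_le_sum_abs _ _).trans (Finset.sum_le_sum fun n _ => ?_)
    rw [abs_mul, abs_div]
    refine mul_le_mul ?_ ?_ (abs_nonneg _) (by positivity)
    · rw [abs_of_nonneg (by positivity : (0:ℝ) ≤ (n:ℝ)^2)]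
      gcongr
      exact he n
    · refine (Finset.abs_sum_le_sum_abs _ _).trans (Finset.sum_le_sum fun m _ => ?_)
      rw [abs_div, abs_of_nonneg (by positivity : (0:ℝ) ≤ (m:ℝ))]
      gcongr
      exact ih m

end ZTO

namespace ZTO
open Finset Filter Topology

/-- partial products -/
noncomputable def CC (w : ℝ) (m : ℕ) : ℝ := ∏ k ∈ range m, (1 + w / ((k:ℝ)+1)^3)

lemma CC_succ (w : ℝ) (m : ℕ) : CC w (m+1) = CC w m * (1 + w / ((m:ℝ)+1)^3) := by
  simp [CC, Finset.prod_range_succ]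

lemma CC_zero (w : ℝ) : CC w 0 = 1 := by simp [CC]

lemma CC_pos {w : ℝ} (hw : 0 ≤ w) (m : ℕ) : 0 < CC w m :=
  Finset.prod_pos fun k _ => by positivity

lemma CC_mono {w : ℝ} (hw : 0 ≤ w) : Monotone (CC w) := by
  refine monotone_nat_of_le_succ fun m => ?_
  rw [CC_succ]
  have h1 := CC_pos hw m
  have h2 : 0 ≤ w / ((m:ℝ)+1)^3 := by positivity
  nlinarith

lemma summable_cube : Summable (fun k : ℕ => 1 / ((k:ℝ)+1)^3) := by
  have := (summable_nat_add_iff 1).2 (Real.summable_one_div_nat_pow.2 (by norm_num : 1 < 3))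
  simpa using this

lemma summable_sq : Summable (fun k : ℕ => 1 / ((k:ℝ)+1)^2) := by
  have := (summable_nat_add_iff 1).2 (Real.summable_one_div_nat_pow.2 (by norm_num : 1 < 2))
  simpa using this

lemma CC_le {w : ℝ} (hw : 0 ≤ w) (m : ℕ) : CC w m ≤ Real.exp (w * ∑' k : ℕ, 1 / ((k:ℝ)+1)^3) := by
  have h1 : CC w m ≤ Real.exp (∑ k ∈ range m, w * (1 / ((k:ℝ)+1)^3)) := by
    rw [Real.exp_sum]
    refine Finset.prod_le_prod (fun k _ => by positivity) fun k _ => ?_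
    have := Real.add_one_le_exp (w * (1 / ((k:ℝ)+1)^3))
    calc 1 + w / ((k:ℝ)+1)^3 = w * (1 / ((k:ℝ)+1)^3) + 1 := by ring
      _ ≤ _ := this
  refine h1.trans (Real.exp_le_exp.2 ?_)
  rw [← Finset.mul_sum]
  refine mul_le_mul_of_nonneg_left ?_ hw
  exact summable_cube.sum_le_tsum _ fun k _ => by positivity

noncomputable def Cinf (w : ℝ) : ℝ := ⨆ m, CC w m

lemma CC_bdd {w : ℝ} (hw : 0 ≤ w) : BddAbove (Set.range (CC w)) :=
  ⟨_, by rintro _ ⟨m, rfl⟩; exact CC_le hw m⟩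

lemma CC_tendsto {w : ℝ} (hw : 0 ≤ w) : Tendsto (CC w) atTop (𝓝 (Cinf w)) :=
  tendsto_atTop_ciSup (CC_mono hw) (CC_bdd hw)

lemma CC_le_Cinf {w : ℝ} (hw : 0 ≤ w) (m : ℕ) : CC w m ≤ Cinf w := le_ciSup (CC_bdd hw) m

/-- connector: `N! m! / (N+m)!`. -/
noncomputable def KK (N m : ℕ) : ℝ := (N.factorial : ℝ) * m.factorial / (N+m).factorial

lemma KK_pos (N m : ℕ) : 0 < KK N m := by unfold KK; positivity

lemma KK_zero_right (N : ℕ) : KK N 0 = 1 := by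
  unfold KK; simp [Nat.factorial_ne_zero]

lemma KK_zero_left (m : ℕ) : KK 0 m = 1 := by
  unfold KK; simp [Nat.factorial_ne_zero]

lemma KK_succ_left (N m : ℕ) : KK N m * ((N:ℝ)+1) = KK (N+1) m * ((N:ℝ)+1+m) := by
  unfold KK
  have : N + 1 + m = (N + m) + 1 := by ring
  rw [this, Nat.factorial_succ, Nat.factorial_succ]
  push_cast
  field_simp
  ring

lemma KK_succ_right (N m : ℕ) : KK N m * ((m:ℝ)+1) = KK N (m+1) * ((N:ℝ)+m+1) := by
  unfold KK
  have : N + (m + 1) = (N + m) + 1 := by ring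
  rw [this, Nat.factorial_succ, Nat.factorial_succ]
  push_cast
  field_simp

lemma KK_le_one (N m : ℕ) : KK N m ≤ 1 := by
  induction m with
  | zero => rw [KK_zero_right]
  | succ m ih =>
    have h := KK_succ_right N m
    have h2 := KK_pos N (m+1)
    have : (0:ℝ) ≤ N := by positivity
    have : (0:ℝ) ≤ m := by positivity
    nlinarith [mul_nonneg h2.le (by positivity : (0:ℝ) ≤ N)]

lemma KK_anti (N m : ℕ) : KK N (m+1) ≤ KK N m := by
  have h := KK_succ_right N m
  have h2 := KK_pos N (m+1)
  have hm : (0:ℝ) ≤ m := by positivity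
  have := mul_nonneg h2.le (by positivity : (0:ℝ) ≤ N)
  nlinarith

lemma KK_le (N m : ℕ) : KK N (m+1) ≤ 1 / ((N:ℝ)+1) := by
  induction m with
  | zero =>
    have h := KK_succ_right N 0
    rw [KK_zero_right] at h
    rw [le_div_iff₀ (by positivity)]
    push_cast at h
    simp at h
    simp
    linarith
  | succ m ih => exact (KK_anti N (m+1)).trans ih

lemma KK_symm (N m : ℕ) : KK N m = KK m N := by
  unfold KK; rw [add_comm N m, mul_comm (N.factorial : ℝ)]

noncomputable def cc (w : ℝ) (m : ℕ) : ℝ := CC w m * w / ((m:ℝ)+1)^3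

lemma cc_eq (w : ℝ) (m : ℕ) : cc w m = CC w (m+1) - CC w m := by
  rw [CC_succ, cc]; ring


lemma cc_nonneg {w : ℝ} (hw : 0 ≤ w) (m : ℕ) : 0 ≤ cc w m := by
  have := CC_pos hw m
  unfold cc; positivity

lemma cc_mul_le {w : ℝ} (hw : 0 ≤ w) (m : ℕ) : cc w m * ((m:ℝ)+1) ≤ Cinf w * w * (1 / ((m:ℝ)+1)^2) := by
  unfold cc
  have := CC_le_Cinf hw m
  have h : CC w m * w / ((m:ℝ)+1)^3 * ((m:ℝ)+1) = CC w m * w * (1 / ((m:ℝ)+1)^2) := by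
    field_simp
  rw [h]
  gcongr

lemma cc_le_mul {w : ℝ} (hw : 0 ≤ w) (m : ℕ) : cc w m ≤ cc w m * ((m:ℝ)+1) := by
  have := cc_nonneg hw m
  have hm : (0:ℝ) ≤ m := by positivity
  nlinarith [mul_nonneg this hm]

lemma summable_ccm {w : ℝ} (hw : 0 ≤ w) : Summable (fun m : ℕ => cc w m * ((m:ℝ)+1)) :=
  Summable.of_nonneg_of_le (fun m => mul_nonneg (cc_nonneg hw m) (by positivity))
    (cc_mul_le hw) (summable_sq.mul_left _)

lemma summable_cc {w : ℝ} (hw : 0 ≤ w) : Summable (cc w) :=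
  Summable.of_nonneg_of_le (cc_nonneg hw) (cc_le_mul hw) (summable_ccm hw)

lemma summable_b {w : ℝ} (hw : 0 ≤ w) (N : ℕ) : Summable (fun m : ℕ => cc w m * ((m:ℝ)+1) * KK N (m+1)) :=
  Summable.of_nonneg_of_le
    (fun m => mul_nonneg (mul_nonneg (cc_nonneg hw m) (by positivity)) (KK_pos _ _).le)
    (fun m => mul_le_of_le_one_right (mul_nonneg (cc_nonneg hw m) (by positivity)) (KK_le_one _ _))
    (summable_ccm hw)

lemma summable_a {w : ℝ} (hw : 0 ≤ w) (N : ℕ) : Summable (fun m : ℕ => cc w m * KK N (m+1)) :=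
  Summable.of_nonneg_of_le
    (fun m => mul_nonneg (cc_nonneg hw m) (KK_pos _ _).le)
    (fun m => mul_le_of_le_one_right (cc_nonneg hw m) (KK_le_one _ _))
    (summable_cc hw)

noncomputable def al (w : ℝ) (N : ℕ) : ℝ := 1 + ∑' m : ℕ, cc w m * KK N (m+1)
noncomputable def be (w : ℝ) (N : ℕ) : ℝ := ∑' m : ℕ, cc w m * ((m:ℝ)+1) * KK N (m+1)

end ZTO

namespace ZTO
open Finset Filter Topology

lemma al_step {w : ℝ} (hw : 0 ≤ w) (N : ℕ) : al w N - al w (N+1) = be w (N+1) / ((N:ℝ)+1) := by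
  unfold al be
  rw [add_sub_add_left_eq_sub, ← (summable_a hw N).tsum_sub (summable_a hw (N+1)), ← tsum_div_const]
  refine tsum_congr fun m => ?_
  have h := KK_succ_left N (m+1)
  push_cast at h
  rw [eq_div_iff (by positivity)]
  linear_combination cc w m * h

lemma KK_tendsto (N : ℕ) : Tendsto (fun m => KK (N+1) m) atTop (𝓝 0) := by
  refine squeeze_zero (fun m => (KK_pos _ _).le) (fun m => ?_) tendsto_one_div_add_atTop_nhds_zero_nat
  rw [KK_symm]
  exact KK_le m N

lemma summable_d {w : ℝ} (hw : 0 ≤ w) (N : ℕ) :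
    Summable (fun m : ℕ => CC w m * KK (N+1) (m+1) / ((m:ℝ)+1)) := by
  refine Summable.of_nonneg_of_le (fun m => ?_) (fun m => ?_) (summable_sq.mul_left (Cinf w))
  · have := CC_pos hw m
    have := KK_pos (N+1) (m+1)
    positivity
  · have h1 := CC_pos hw m
    have h2 := KK_pos (N+1) (m+1)
    have h3 := CC_le_Cinf hw m
    have h4 : KK (N+1) (m+1) ≤ 1 / ((m:ℝ)+1) := by
      have := (KK_anti (N+1) m).trans ((KK_symm (N+1) m).le.trans (KK_le m N))
      exact this
    have h5 : (0:ℝ) ≤ 1 / ((m:ℝ)+1) := by positivity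
    calc CC w m * KK (N+1) (m+1) / ((m:ℝ)+1) ≤ Cinf w * (1 / ((m:ℝ)+1)) / ((m:ℝ)+1) := by
          gcongr
          exact h1.le.trans h3
      _ = _ := by field_simp

lemma tele {w : ℝ} (hw : 0 ≤ w) (N : ℕ) :
    ((N:ℝ)+1) * ∑' m : ℕ, CC w m * KK (N+1) (m+1) / ((m:ℝ)+1) = al w (N+1) := by
  have hs := ((summable_d hw N).mul_left ((N:ℝ)+1)).sub (summable_a hw (N+1))
  have h1 := hs.hasSum.tendsto_sum_nat
  have h2 : ∀ n, ∑ i ∈ range n, (((N:ℝ)+1) * (CC w i * KK (N+1) (i+1) / ((i:ℝ)+1)) - cc w i * KK (N+1) (i+1))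
      = 1 - CC w n * KK (N+1) n := by
    intro n
    induction n with
    | zero => simp [CC_zero, KK_zero_right]
    | succ n ih =>
      rw [sum_range_succ, ih, cc_eq]
      have h := KK_succ_right (N+1) n
      push_cast at h
      have hn : ((n:ℝ)+1) ≠ 0 := by positivity
      field_simp
      linear_combination (-CC w n) * h
  have h3 : Tendsto (fun n => 1 - CC w n * KK (N+1) n) atTop (𝓝 (1 - Cinf w * 0)) :=
    ((CC_tendsto hw).mul (KK_tendsto N)).const_sub 1
  have h4 := tendsto_nhds_unique h1 (h3.congr fun n => (h2 n).symm)
  rw [((summable_d hw N).mul_left ((N:ℝ)+1)).tsum_sub (summable_a hw (N+1)), tsum_mul_left] at h4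
  unfold al
  linarith

lemma be_step {w : ℝ} (hw : 0 ≤ w) (N : ℕ) : be w N - be w (N+1) = w * al w (N+1) / ((N:ℝ)+1)^2 := by
  rw [← tele hw N]
  unfold be
  rw [← (summable_b hw N).tsum_sub (summable_b hw (N+1))]
  have : w * (((N:ℝ)+1) * ∑' m : ℕ, CC w m * KK (N+1) (m+1) / ((m:ℝ)+1)) / ((N:ℝ)+1)^2
      = (w / ((N:ℝ)+1)) * ∑' m : ℕ, CC w m * KK (N+1) (m+1) / ((m:ℝ)+1) := by
    field_simp
  rw [this, ← tsum_mul_left]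
  refine tsum_congr fun m => ?_
  have h := KK_succ_left N (m+1)
  push_cast at h
  unfold cc
  have hn : ((m:ℝ)+1) ≠ 0 := by positivity
  have hN : ((N:ℝ)+1) ≠ 0 := by positivity
  field_simp
  linear_combination (w * CC w m) * h

lemma al_zero {w : ℝ} (hw : 0 ≤ w) : al w 0 = Cinf w := by
  unfold al
  simp only [KK_zero_left, mul_one]
  have h1 := (summable_cc hw).hasSum.tendsto_sum_nat
  have h2 : ∀ n, ∑ i ∈ range n, cc w i = CC w n - 1 := by
    intro n
    simp only [cc_eq]
    rw [Finset.sum_range_sub, CC_zero]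
  have h4 := tendsto_nhds_unique h1 (((CC_tendsto hw).sub_const 1).congr fun n => (h2 n).symm)
  rw [h4]; ring

lemma al_inv {w : ℝ} (hw : 0 ≤ w) (N : ℕ) :
    al w N * (ab (fun _ => 1) w N).1 + be w N * (ab (fun _ => 1) w N).2 = Cinf w := by
  induction N with
  | zero => simp [ab, al_zero hw]
  | succ N ih =>
    rw [← ih]
    simp only [ab]
    have h1 := al_step hw N
    have h2 := be_step hw N
    have h1' : al w N = al w (N+1) + be w (N+1) / ((N:ℝ)+1) := by linarith
    have h2' : be w N = be w (N+1) + w * al w (N+1) / ((N:ℝ)+1)^2 := by linarith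
    rw [h1', h2']
    ring

lemma ab_nonneg {w : ℝ} (hw : 0 ≤ w) (N : ℕ) :
    1 ≤ (ab (fun _ => 1) w N).1 ∧ 0 ≤ (ab (fun _ => 1) w N).2 := by
  induction N with
  | zero => simp [ab]
  | succ N ih =>
    obtain ⟨h1, h2⟩ := ih
    simp only [ab]
    have h0 : 0 ≤ (ab (fun _ => 1) w N).1 := by linarith
    have : 0 ≤ w * (1 / ((N:ℝ)+1)^2 * (ab (fun _ => 1) w N).2) := by positivity
    exact ⟨by linarith, by positivity⟩

lemma al_ge {w : ℝ} (hw : 0 ≤ w) (N : ℕ) : 1 ≤ al w N := by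
  unfold al
  have : 0 ≤ ∑' m : ℕ, cc w m * KK N (m+1) :=
    tsum_nonneg fun m => mul_nonneg (cc_nonneg hw m) (KK_pos _ _).le
  linarith

lemma be_ge {w : ℝ} (hw : 0 ≤ w) (N : ℕ) : 0 ≤ be w N :=
  tsum_nonneg fun m => mul_nonneg (mul_nonneg (cc_nonneg hw m) (by positivity)) (KK_pos _ _).le

lemma a_le {w : ℝ} (hw : 0 ≤ w) (N : ℕ) : (ab (fun _ => 1) w N).1 ≤ Cinf w := by
  have h := al_inv hw N
  obtain ⟨h1, h2⟩ := ab_nonneg hw N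
  have h3 := al_ge hw N
  have h4 := mul_nonneg (be_ge hw N) h2
  nlinarith

lemma al_le {w : ℝ} (hw : 0 ≤ w) (N : ℕ) : al w N ≤ 1 + (∑' m, cc w m) * (1 / ((N:ℝ)+1)) := by
  unfold al
  rw [← tsum_mul_right]
  gcongr
  · exact summable_a hw N
  · exact (summable_cc hw).mul_right _
  · exact cc_nonneg hw _
  · exact KK_le _ _

lemma be_le {w : ℝ} (hw : 0 ≤ w) (N : ℕ) :
    be w N ≤ (∑' m : ℕ, cc w m * ((m:ℝ)+1)) * (1 / ((N:ℝ)+1)) := by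
  unfold be
  rw [← tsum_mul_right]
  gcongr
  · exact summable_b hw N
  · exact (summable_ccm hw).mul_right _
  · exact mul_nonneg (cc_nonneg hw _) (by positivity)
  · exact KK_le _ _

lemma al_tendsto {w : ℝ} (hw : 0 ≤ w) : Tendsto (al w) atTop (𝓝 1) := by
  have : Tendsto (fun N : ℕ => 1 + (∑' m, cc w m) * (1 / ((N:ℝ)+1))) atTop (𝓝 (1 + (∑' m, cc w m) * 0)) :=
    (tendsto_one_div_add_atTop_nhds_zero_nat.const_mul _).const_add 1
  rw [mul_zero, add_zero] at this
  exact tendsto_of_tendsto_of_tendsto_of_le_of_le tendsto_const_nhds this (al_ge hw) (al_le hw)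

/-- Cesaro bound: `b_N/(N+1) → 0`. -/
lemma b_tendsto {w : ℝ} (hw : 0 ≤ w) :
    Tendsto (fun N : ℕ => (ab (fun _ => 1) w N).2 * (1 / ((N:ℝ)+1))) atTop (𝓝 0) := by
  have hb : ∀ N, (ab (fun _ => 1) w N).2 = ∑ i ∈ range N, (ab (fun _ => 1) w i).1 / ((i:ℝ)+1) := by
    intro N
    induction N with
    | zero => simp [ab]
    | succ N ih => rw [sum_range_succ, ← ih]; simp [ab]
  have h1 : Tendsto (fun i : ℕ => Cinf w * (1 / ((i:ℝ)+1))) atTop (𝓝 0) := by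
    simpa using tendsto_one_div_add_atTop_nhds_zero_nat.const_mul (Cinf w)
  have h2 := h1.cesaro
  have hC : 0 ≤ Cinf w := le_trans (CC_pos hw 0).le (CC_le_Cinf hw 0)
  refine squeeze_zero' (Eventually.of_forall fun N => ?_) ?_ h2
  · have := (ab_nonneg hw N).2
    positivity
  · filter_upwards [eventually_gt_atTop 0] with N hN
    rw [hb, mul_comm]
    have hN' : (0:ℝ) < N := by exact_mod_cast hN
    have h3 : ∑ i ∈ range N, (ab (fun _ => 1) w i).1 / ((i:ℝ)+1) ≤ ∑ i ∈ range N, Cinf w * (1 / ((i:ℝ)+1)) := by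
      refine Finset.sum_le_sum fun i _ => ?_
      rw [mul_one_div]
      have := a_le hw i
      gcongr
    have h4 : 0 ≤ ∑ i ∈ range N, Cinf w * (1 / ((i:ℝ)+1)) :=
      Finset.sum_nonneg fun i _ => by positivity
    have h5 : 1 / ((N:ℝ)+1) ≤ (N:ℝ)⁻¹ := by
      rw [one_div]
      gcongr
      linarith
    calc _ ≤ 1 / ((N:ℝ)+1) * ∑ i ∈ range N, Cinf w * (1 / ((i:ℝ)+1)) := by gcongr
      _ ≤ _ := by gcongr

theorem a_tendsto {w : ℝ} (hw : 0 ≤ w) :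
    Tendsto (fun N => (ab (fun _ => 1) w N).1) atTop (𝓝 (Cinf w)) := by
  have h1 : Tendsto (fun N => be w N * (ab (fun _ => 1) w N).2) atTop (𝓝 0) := by
    refine squeeze_zero (fun N => mul_nonneg (be_ge hw N) (ab_nonneg hw N).2) (fun N => ?_)
      (by simpa using (b_tendsto hw).const_mul (∑' m : ℕ, cc w m * ((m:ℝ)+1)))
    have h2 := mul_le_mul_of_nonneg_right (be_le hw N) (ab_nonneg hw N).2
    refine h2.trans (le_of_eq ?_)
    ring
  have h2 : Tendsto (fun N => (Cinf w - be w N * (ab (fun _ => 1) w N).2) / al w N) atTop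
      (𝓝 ((Cinf w - 0) / 1)) := (h1.const_sub _).div (al_tendsto hw) one_ne_zero
  simp only [sub_zero, div_one] at h2
  refine h2.congr fun N => ?_
  have := al_ge hw N
  rw [div_eq_iff (by linarith)]
  linarith [al_inv hw N]

end ZTO

namespace ZTO
open Finset Filter Topology

lemma sl_le (l N : ℕ) : sl (fun _ => 1) l N ≤ Cinf 1 := by
  refine (sl_mono l (Nat.le_succ N)).trans ?_
  have h := (hasSum_ab (fun _ => 1) 1 N).1
  refine le_trans ?_ (a_le zero_le_one N)
  have := h.summable.le_tsum l (fun j _ => by simpa using sl_nonneg j (N+1))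
  rw [h.tsum_eq] at this
  simpa using this

lemma tm_one_nonneg {l : ℕ} (p : (Fin l → ℕ) × (Fin l → ℕ)) : 0 ≤ tm (fun _ => 1) p := by
  unfold tm
  split_ifs
  · exact Finset.prod_nonneg fun i _ => by positivity
  · exact le_rfl

lemma abs_tm_le {e : ℕ → ℝ} (he : ∀ n, |e n| ≤ 1) {l : ℕ} (p : (Fin l → ℕ) × (Fin l → ℕ)) :
    |tm e p| ≤ tm (fun _ => 1) p := by
  unfold tm
  split_ifs
  · rw [Finset.abs_prod]
    refine Finset.prod_le_prod (fun i _ => abs_nonneg _) fun i _ => ?_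
    rw [abs_div, abs_of_nonneg (by positivity : (0:ℝ) ≤ (p.1 i : ℝ) ^ 2 * (p.2 i : ℝ))]
    have := he (p.1 i)
    gcongr
  · simp

def bb (l N : ℕ) : Finset ((Fin l → ℕ) × (Fin l → ℕ)) := box l N ×ˢ box l N

lemma bb_mono (l : ℕ) : Monotone (bb l) := by
  intro M N h p hp
  simp only [bb, mem_product, mem_box] at hp ⊢
  exact ⟨fun i => (hp.1 i).trans_le h, fun i => (hp.2 i).trans_le h⟩

lemma bb_mem (l : ℕ) (p : (Fin l → ℕ) × (Fin l → ℕ)) : ∃ N, p ∈ bb l N := by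
  refine ⟨(∑ i, p.1 i) + (∑ i, p.2 i) + 1, ?_⟩
  simp only [bb, mem_product, mem_box]
  refine ⟨fun i => ?_, fun i => ?_⟩
  · have := Finset.single_le_sum (f := p.1) (fun j _ => Nat.zero_le _) (mem_univ i)
    omega
  · have := Finset.single_le_sum (f := p.2) (fun j _ => Nat.zero_le _) (mem_univ i)
    omega

lemma bb_tendsto (l : ℕ) : Tendsto (bb l) atTop atTop :=
  tendsto_atTop_finset_of_monotone (bb_mono l) (bb_mem l)

lemma sum_bb (e : ℕ → ℝ) (l N : ℕ) : ∑ p ∈ bb l N, tm e p = sl e l N := by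
  rw [← sum_box_tm, bb, Finset.sum_product]

lemma summable_tm_one (l : ℕ) : Summable (fun p : (Fin l → ℕ) × (Fin l → ℕ) => tm (fun _ => 1) p) := by
  refine summable_of_sum_le (c := Cinf 1) tm_one_nonneg fun u => ?_
  obtain ⟨N, hN⟩ := ((bb_tendsto l).eventually_ge_atTop u).exists
  refine (Finset.sum_le_sum_of_subset_of_nonneg hN fun p _ _ => tm_one_nonneg p).trans ?_
  rw [sum_bb]
  exact sl_le l N

lemma summable_tm {e : ℕ → ℝ} (he : ∀ n, |e n| ≤ 1) (l : ℕ) :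
    Summable (fun p : (Fin l → ℕ) × (Fin l → ℕ) => tm e p) :=
  Summable.of_norm_bounded (summable_tm_one l) fun p => abs_tm_le he p

noncomputable def zz (e : ℕ → ℝ) (l : ℕ) : ℝ := ∑' p : (Fin l → ℕ) × (Fin l → ℕ), tm e p

lemma sl_tendsto {e : ℕ → ℝ} (he : ∀ n, |e n| ≤ 1) (l : ℕ) : Tendsto (sl e l) atTop (𝓝 (zz e l)) := by
  have h := (summable_tm he l).hasSum
  exact (h.comp (bb_tendsto l)).congr fun N => sum_bb e l N

lemma abs_sl_le' {e : ℕ → ℝ} (he : ∀ n, |e n| ≤ 1) (l N : ℕ) : |sl e l N| ≤ Cinf 1 :=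
  (abs_sl_le he l N).trans (sl_le l N)

lemma abs_zz_le {e : ℕ → ℝ} (he : ∀ n, |e n| ≤ 1) (l : ℕ) : |zz e l| ≤ Cinf 1 :=
  le_of_tendsto (sl_tendsto he l).abs (Eventually.of_forall fun N => abs_sl_le' he l N)

lemma a_tendsto_zz {e : ℕ → ℝ} (he : ∀ n, |e n| ≤ 1) {w : ℝ} (h0 : 0 ≤ w) (h1 : w < 1) :
    Tendsto (fun N => (ab e w N).1) atTop (𝓝 (∑' l, w ^ l * zz e l)) := by
  have h : Tendsto (fun N => ∑' l, w ^ l * sl e l (N+1)) atTop (𝓝 (∑' l, w ^ l * zz e l)) := by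
    refine tendsto_tsum_of_dominated_convergence (bound := fun l => w ^ l * Cinf 1)
      ((summable_geometric_of_lt_one h0 h1).mul_right _) (fun l => ?_) (Eventually.of_forall fun N l => ?_)
    · exact ((sl_tendsto he l).comp (tendsto_add_atTop_nat 1)).const_mul _
    · rw [norm_mul, Real.norm_eq_abs, Real.norm_eq_abs, abs_of_nonneg (by positivity : 0 ≤ w ^ l)]
      have := abs_sl_le' he l (N+1)
      gcongr
  exact h.congr fun N => (hasSum_ab e w N).1.tsum_eq

/-- the alternating sign -/
def ep (n : ℕ) : ℝ := (-1) ^ n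

lemma abs_ep (n : ℕ) : |ep n| ≤ 1 := by simp [ep]
lemma abs_one' (n : ℕ) : |(fun _ : ℕ => (1:ℝ)) n| ≤ 1 := by simp

/-- comparison of coefficients -/
lemma coeff_eq {c d : ℕ → ℝ} {K : ℝ} (hc : ∀ n, |c n| ≤ K) (hd : ∀ n, |d n| ≤ K)
    (h : ∀ w : ℝ, 0 < w → w < 1/8 → ∑' l, w ^ l * c l = ∑' l, (8*w) ^ l * d l) (n : ℕ) :
    c n = 8 ^ n * d n := by
  have key : ∀ (c : ℕ → ℝ) (r : ℝ), 0 < r → (∀ n, |c n| * r ^ n ≤ K) →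
      HasFPowerSeriesAt (fun w : ℝ => ∑' l, w ^ l * c l) (FormalMultilinearSeries.ofScalars ℝ c) 0 := by
    intro c r hr hc
    set q := FormalMultilinearSeries.ofScalars ℝ c with hq
    have hrad : ENNReal.ofReal r ≤ q.radius := by
      rw [ENNReal.ofReal]
      refine q.le_radius_of_bound K fun n => ?_
      have : ‖q n‖ ≤ |c n| := by
        rw [hq]
        simpa using (FormalMultilinearSeries.ofScalars_norm (𝕜 := ℝ) (E := ℝ) c n).le
      refine le_trans ?_ (hc n)
      rw [Real.coe_toNNReal _ hr.le]
      gcongr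
    have hpos : 0 < q.radius := lt_of_lt_of_le (by simpa using hr) hrad
    have := (q.hasFPowerSeriesOnBall hpos).hasFPowerSeriesAt
    convert this using 1
    funext w
    rw [FormalMultilinearSeries.sum]
    refine tsum_congr fun n => ?_
    rw [hq, FormalMultilinearSeries.ofScalars_apply_eq]
    simp [mul_comm]
  have h1 := key c 1 one_pos (by simpa using hc)
  have h2 := key (fun n => 8 ^ n * d n) (1/8) (by norm_num) (fun n => by
    rw [abs_mul, abs_of_nonneg (by positivity : (0:ℝ) ≤ 8 ^ n), mul_right_comm, ← mul_pow]
    norm_num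
    exact hd n)
  have heq : ∀ᶠ w in 𝓝 (0:ℝ), (∑' l, w ^ l * c l) = ∑' l, w ^ l * (8 ^ l * d l) := by
    refine (h1.analyticAt.frequently_eq_iff_eventually_eq h2.analyticAt).1 ?_
    have hf : ∃ᶠ w in 𝓝[>] (0:ℝ), (∑' l, w ^ l * c l) = ∑' l, w ^ l * (8 ^ l * d l) := by
      refine Eventually.frequently ?_
      filter_upwards [Ioo_mem_nhdsGT (by norm_num : (0:ℝ) < 1/8)] with w hw
      rw [h w hw.1 hw.2]
      refine tsum_congr fun l => ?_
      rw [mul_pow]; ring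
    exact hf.filter_mono (nhdsWithin_mono _ fun x hx => ne_of_gt hx)
  have h3 := (h1.congr heq).eq_formalMultilinearSeries h2
  have h4 := congrArg (fun q => FormalMultilinearSeries.coeff q n) h3
  simpa [FormalMultilinearSeries.coeff_ofScalars] using h4

theorem main_of {l : ℕ} (H : ∀ w : ℝ, 0 < w → w < 1/8 →
    Tendsto (fun N => (ab ep (8*w) N).1) atTop (𝓝 (Cinf w))) :
    zz (fun _ => 1) l = 8 ^ l * zz ep l := by
  refine coeff_eq (abs_zz_le abs_one') (abs_zz_le abs_ep) (fun w h0 h1 => ?_) l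
  have e1 := tendsto_nhds_unique (a_tendsto h0.le) (a_tendsto_zz abs_one' h0.le (by linarith))
  have e2 := tendsto_nhds_unique (H w h0 h1) (a_tendsto_zz abs_ep (by linarith) (by linarith))
  rw [← e1, ← e2]

lemma zz_one (l : ℕ) : zz (fun _ => 1) l = ∑' p : {p : (Fin l → ℕ) × (Fin l → ℕ) //
      (∀ i, p.2 i < p.1 i) ∧ (∀ i j, i < j → p.1 j < p.2 i) ∧ ∀ i, 1 ≤ p.2 i},
    ∏ i : Fin l, (1 : ℝ) / ((p.1.1 i : ℝ) ^ 2 * (p.1.2 i : ℝ)) := by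
  classical
  have := tsum_subtype {p : (Fin l → ℕ) × (Fin l → ℕ) | Chain p}
    (fun p => ∏ i : Fin l, (1 : ℝ) / ((p.1 i : ℝ) ^ 2 * (p.2 i : ℝ)))
  refine Eq.trans ?_ this.symm
  refine tsum_congr fun p => ?_
  rw [Set.indicator_apply]
  unfold tm
  simp only [Set.mem_ofPred_eq]

lemma zz_ep (l : ℕ) : zz ep l = ∑' p : {p : (Fin l → ℕ) × (Fin l → ℕ) //
      (∀ i, p.2 i < p.1 i) ∧ (∀ i j, i < j → p.1 j < p.2 i) ∧ ∀ i, 1 ≤ p.2 i},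
    (-1 : ℝ) ^ (∑ i : Fin l, p.1.1 i)
      / ∏ i : Fin l, ((p.1.1 i : ℝ) ^ 2 * (p.1.2 i : ℝ)) := by
  classical
  have := tsum_subtype {p : (Fin l → ℕ) × (Fin l → ℕ) | Chain p}
    (fun p => (-1 : ℝ) ^ (∑ i : Fin l, p.1 i)
      / ∏ i : Fin l, ((p.1 i : ℝ) ^ 2 * (p.2 i : ℝ)))
  refine Eq.trans ?_ this.symm
  refine tsum_congr fun p => ?_
  rw [Set.indicator_apply]
  unfold tm ep
  simp only [Set.mem_ofPred_eq, Finset.prod_div_distrib, Finset.prod_pow_eq_pow_sum]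

end ZTO

namespace ZTO
open Finset Filter Topology

lemma conv_pair {u v c : ℕ → ℝ} (hc : ∀ k, 0 ≤ c k) (hs : Summable c)
    (hu : ∀ k, |u (k+1) - u k| ≤ c k * (|u k| + |v k|))
    (hv : ∀ k, |v (k+1) - v k| ≤ c k * (|u k| + |v k|)) :
    (∃ a, Tendsto u atTop (𝓝 a)) ∧ ∃ b, Tendsto v atTop (𝓝 b) := by
  have hM : ∀ k, |u k| + |v k| ≤ (|u 0| + |v 0|) * Real.exp (∑ i ∈ range k, 2 * c i) := by
    intro k
    induction k with
    | zero => simp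
    | succ k ih =>
      rw [sum_range_succ, Real.exp_add, ← mul_assoc]
      have h1 : |u (k+1)| ≤ |u k| + c k * (|u k| + |v k|) := by
        have := abs_sub_abs_le_abs_sub (u (k+1)) (u k)
        linarith [hu k]
      have h2 : |v (k+1)| ≤ |v k| + c k * (|u k| + |v k|) := by
        have := abs_sub_abs_le_abs_sub (v (k+1)) (v k)
        linarith [hv k]
      have h3 := Real.add_one_le_exp (2 * c k)
      have h4 : 0 ≤ |u k| + |v k| := by positivity
      calc |u (k+1)| + |v (k+1)| ≤ (|u k| + |v k|) * (2 * c k + 1) := by linarith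
        _ ≤ (|u k| + |v k|) * Real.exp (2 * c k) := by gcongr
        _ ≤ _ := by gcongr
  have hB : ∀ k, |u k| + |v k| ≤ (|u 0| + |v 0|) * Real.exp (∑' i, 2 * c i) := by
    intro k
    refine (hM k).trans ?_
    gcongr
    exact (hs.mul_left 2).sum_le_tsum _ fun i _ => mul_nonneg zero_le_two (hc i)
  set B := (|u 0| + |v 0|) * Real.exp (∑' i, 2 * c i)
  have hs' : Summable (fun k => c k * B) := hs.mul_right B
  have key : ∀ x : ℕ → ℝ, (∀ k, |x (k+1) - x k| ≤ c k * (|u k| + |v k|)) → ∃ a, Tendsto x atTop (𝓝 a) := by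
    intro x hx
    refine cauchySeq_tendsto_of_complete (cauchySeq_of_dist_le_of_summable _ (fun n => ?_) hs')
    rw [dist_comm, Real.dist_eq]
    refine (hx n).trans ?_
    exact mul_le_mul_of_nonneg_left (hB n) (hc n)
  exact ⟨key u hu, key v hv⟩

lemma even_odd {u : ℕ → ℝ} {a : ℝ} (h0 : Tendsto (fun k => u (2*k)) atTop (𝓝 a))
    (h1 : Tendsto (fun k => u (2*k+1)) atTop (𝓝 a)) : Tendsto u atTop (𝓝 a) := by
  rw [Metric.tendsto_atTop] at *
  intro ε hε
  obtain ⟨A, hA⟩ := h0 ε hε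
  obtain ⟨B, hB⟩ := h1 ε hε
  refine ⟨2*A+2*B+2, fun n hn => ?_⟩
  rcases Nat.even_or_odd' n with ⟨k, rfl | rfl⟩
  · exact hA k (by omega)
  · exact hB k (by omega)

lemma ep_succ (n : ℕ) : ep (n+1) = - ep n := by simp [ep, pow_succ]
lemma ep_zero : ep 0 = 1 := by simp [ep]
lemma ep_mul (n : ℕ) : ep n * ep n = 1 := by
  unfold ep; rw [← mul_pow]; simp
lemma ep_two (k : ℕ) : ep (2*k) = 1 := by simp [ep]

noncomputable def xy (W x0 y0 : ℝ) : ℕ → ℝ × ℝ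
  | 0 => (x0, y0)
  | N + 1 => ((xy W x0 y0 N).1 + ep (N+1) * (xy W x0 y0 N).2 / ((N:ℝ)+1),
     (xy W x0 y0 N).2 + (-(W/2)) * ((1 + ep (N+1)) * (xy W x0 y0 N).1) / ((N:ℝ)+1)^2)

lemma xy_odd (W x0 y0 : ℝ) (k : ℕ) :
    xy W x0 y0 (2*k+1) = ((xy W x0 y0 (2*k)).1 - (xy W x0 y0 (2*k)).2 / (2*(k:ℝ)+1), (xy W x0 y0 (2*k)).2) := by
  rw [xy, ep_succ, ep_two]
  push_cast
  ext <;> (simp; try ring)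

lemma xy_even (W x0 y0 : ℝ) (k : ℕ) :
    xy W x0 y0 (2*(k+1)) = ((xy W x0 y0 (2*k)).1 - (xy W x0 y0 (2*k)).2 / ((2*(k:ℝ)+1)*(2*(k:ℝ)+2)),
      (xy W x0 y0 (2*k)).2 - W * ((xy W x0 y0 (2*k)).1 - (xy W x0 y0 (2*k)).2 / (2*(k:ℝ)+1)) / (2*(k:ℝ)+2)^2) := by
  have : 2*(k+1) = 2*k+1+1 := by ring
  rw [this, xy, xy_odd, ep_succ, ep_succ, ep_two]
  push_cast
  have h1 : (2*(k:ℝ)+1) ≠ 0 := by positivity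
  have h2 : (2*(k:ℝ)+2) ≠ 0 := by positivity
  have h3 : (2*(k:ℝ)+1+1) ≠ 0 := by positivity
  ext
  · simp only
    field_simp
    ring
  · simp only
    field_simp
    ring

lemma xy_conv {W : ℝ} (hW : 0 ≤ W) (x0 y0 : ℝ) :
    (∃ a, Tendsto (fun n => (xy W x0 y0 n).1) atTop (𝓝 a)) ∧
    ∃ b, Tendsto (fun n => (xy W x0 y0 n).2) atTop (𝓝 b) := by
  obtain ⟨⟨a, ha⟩, b, hb⟩ := conv_pair (u := fun k => (xy W x0 y0 (2*k)).1)
    (v := fun k => (xy W x0 y0 (2*k)).2) (c := fun k => (1+W) * (1 / ((k:ℝ)+1)^2))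
    (fun k => by positivity) (summable_sq.mul_left _)
    (fun k => by
      rw [xy_even]
      simp only [sub_sub_cancel_left, abs_neg]
      rw [abs_div, abs_of_nonneg (by positivity : (0:ℝ) ≤ (2*(k:ℝ)+1)*(2*(k:ℝ)+2))]
      rw [div_eq_mul_one_div, mul_comm]
      have h1 : 1 / ((2*(k:ℝ)+1)*(2*(k:ℝ)+2)) ≤ (1+W) * (1 / ((k:ℝ)+1)^2) := by
        have : 1 / ((2*(k:ℝ)+1)*(2*(k:ℝ)+2)) ≤ 1 / ((k:ℝ)+1)^2 := by
          gcongr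
          nlinarith [(Nat.cast_nonneg k : (0:ℝ) ≤ k)]
        have h2 : (0:ℝ) ≤ 1 / ((k:ℝ)+1)^2 := by positivity
        nlinarith [mul_nonneg hW h2]
      gcongr
      linarith [abs_nonneg (xy W x0 y0 (2*k)).1])
    (fun k => by
      rw [xy_even]
      simp only [sub_sub_cancel_left, abs_neg]
      rw [abs_div, abs_mul, abs_of_nonneg hW, abs_of_nonneg (by positivity : (0:ℝ) ≤ (2*(k:ℝ)+2)^2)]
      have h1 : |(xy W x0 y0 (2*k)).1 - (xy W x0 y0 (2*k)).2 / (2*(k:ℝ)+1)| ≤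
          |(xy W x0 y0 (2*k)).1| + |(xy W x0 y0 (2*k)).2| := by
        refine (norm_sub_le (xy W x0 y0 (2*k)).1 ((xy W x0 y0 (2*k)).2 / (2*(k:ℝ)+1))).trans ?_
        simp only [Real.norm_eq_abs]
        refine add_le_add_right ?_ _
        rw [abs_div, abs_of_nonneg (by positivity : (0:ℝ) ≤ 2*(k:ℝ)+1)]
        exact div_le_self (abs_nonneg _) (by linarith [(Nat.cast_nonneg k : (0:ℝ) ≤ k)])
      calc _ ≤ (1+W) * (|(xy W x0 y0 (2*k)).1| + |(xy W x0 y0 (2*k)).2|) / ((k:ℝ)+1)^2 := by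
            gcongr
            · linarith
            · linarith
            · norm_num
        _ = _ := by ring)
  have hz : Tendsto (fun k : ℕ => 1 / (2*(k:ℝ)+1)) atTop (𝓝 0) := by
    refine squeeze_zero (fun k => by positivity) (fun k => ?_) tendsto_one_div_add_atTop_nhds_zero_nat
    gcongr
    linarith [(Nat.cast_nonneg k : (0:ℝ) ≤ k)]
  refine ⟨⟨a, even_odd ha ?_⟩, b, even_odd hb ?_⟩
  · have := ha.sub (hb.mul hz)
    rw [mul_zero, sub_zero] at this
    refine this.congr fun k => ?_
    rw [xy_odd]
    simp only
    ring
  · refine hb.congr fun k => ?_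
    rw [xy_odd]

lemma xy_det (w : ℝ) (k : ℕ) :
    (xy (8*w) 1 0 (2*k)).1 * (xy (8*w) 0 1 (2*k)).2 - (xy (8*w) 0 1 (2*k)).1 * (xy (8*w) 1 0 (2*k)).2 = CC w k := by
  induction k with
  | zero => simp [xy, CC_zero]
  | succ k ih =>
    rw [CC_succ, ← ih]
    simp only [xy_even]
    have h1 : (2*(k:ℝ)+1) ≠ 0 := by positivity
    have h2 : (2*(k:ℝ)+2) ≠ 0 := by positivity
    have h3 : ((k:ℝ)+1) ≠ 0 := by positivity
    have h4 : (2*(k:ℝ)+2) = 2 * ((k:ℝ)+1) := by ring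
    rw [h4]
    field_simp
    ring

end ZTO

namespace ZTO
open Finset Filter Topology
open PowerSeries

noncomputable def P1 (W x0 y0 : ℝ) : PowerSeries ℝ := PowerSeries.mk fun n =>
  match n with
  | 0 => x0
  | n + 1 => ep (n+1) * (xy W x0 y0 n).2 / ((n:ℝ)+1)

noncomputable def P2 (W x0 y0 : ℝ) : PowerSeries ℝ := PowerSeries.mk fun n =>
  match n with
  | 0 => y0
  | n + 1 => (-(W/2)) * ((1 + ep (n+1)) * (xy W x0 y0 n).1) / ((n:ℝ)+1)^2

noncomputable def Q (W x0 y0 : ℝ) : PowerSeries ℝ := PowerSeries.mk fun n =>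
  match n with
  | 0 => 0
  | n + 1 => (1 + ep (n+1)) * (xy W x0 y0 n).1 / ((n:ℝ)+1)

noncomputable def PX (W x0 y0 : ℝ) : PowerSeries ℝ := PowerSeries.mk fun n => (xy W x0 y0 n).1

noncomputable def M1 (W x0 y0 : ℝ) : PowerSeries ℝ := PowerSeries.rescale (-1 : ℝ) (P1 W x0 y0)

lemma sum_P1 (W x0 y0 : ℝ) (N : ℕ) :
    ∑ i ∈ range (N+1), coeff i (P1 W x0 y0) = (xy W x0 y0 N).1 := by
  induction N with
  | zero => simp [P1, xy]
  | succ N ih => rw [sum_range_succ, ih]; simp [P1, xy]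

lemma sum_P2 (W x0 y0 : ℝ) (N : ℕ) :
    ∑ i ∈ range (N+1), coeff i (P2 W x0 y0) = (xy W x0 y0 N).2 := by
  induction N with
  | zero => simp [P2, xy]
  | succ N ih => rw [sum_range_succ, ih]; simp [P2, xy]

lemma dP1 (W x0 y0 : ℝ) : (1 + X) * d⁄dX ℝ (P1 W x0 y0) = - P2 W x0 y0 := by
  ext n
  rw [add_mul, one_mul, map_add, coeff_derivative]
  cases n with
  | zero => simp [P1, P2, xy, ep_succ, ep_zero]
  | succ n =>
    rw [coeff_succ_X_mul, coeff_derivative]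
    simp only [P1, P2, coeff_mk, map_neg, xy]
    have h1 : ((n:ℝ)+1) ≠ 0 := by positivity
    have h2 : ((n:ℝ)+1+1) ≠ 0 := by positivity
    have h3 := ep_mul n
    rw [ep_succ, ep_succ]
    push_cast
    field_simp
    linear_combination (W * (xy W x0 y0 n).1) * h3

lemma M1_zero (W x0 y0 : ℝ) : constantCoeff (M1 W x0 y0) = x0 := by
  rw [← coeff_zero_eq_constantCoeff_apply, M1, coeff_rescale]
  simp [P1]

lemma dM1 (W x0 y0 : ℝ) : (1 - X) * d⁄dX ℝ (M1 W x0 y0) = P2 W x0 y0 := by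
  ext n
  rw [sub_mul, one_mul, map_sub, coeff_derivative]
  cases n with
  | zero => simp [M1, P1, P2, xy, ep_succ, ep_zero, coeff_rescale]
  | succ n =>
    rw [coeff_succ_X_mul, coeff_derivative]
    simp only [M1, P1, P2, coeff_mk, coeff_rescale, xy]
    have h1 : ((n:ℝ)+1) ≠ 0 := by positivity
    have h2 : ((n:ℝ)+1+1) ≠ 0 := by positivity
    have h3 := ep_mul n
    have h4 : (-1:ℝ)^n = ep n := rfl
    rw [ep_succ, ep_succ, pow_succ, pow_succ, h4]
    push_cast
    field_simp
    linear_combination (-W * (1 - ep n) * (xy W x0 y0 n).1) * h3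

lemma dP2 (W x0 y0 : ℝ) : X * d⁄dX ℝ (P2 W x0 y0) = C (-(W/2)) * Q W x0 y0 := by
  ext n
  rw [coeff_C_mul]
  cases n with
  | zero => simp [Q]
  | succ n =>
    rw [coeff_succ_X_mul, coeff_derivative]
    simp only [P2, Q, coeff_mk]
    have h1 : ((n:ℝ)+1) ≠ 0 := by positivity
    field_simp

lemma hPX (W x0 y0 : ℝ) : (1 - X) * PX W x0 y0 = P1 W x0 y0 := by
  ext n
  rw [sub_mul, one_mul, map_sub]
  cases n with
  | zero => simp [PX, P1, xy]
  | succ n =>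
    rw [coeff_succ_X_mul]
    simp [PX, P1, xy]

lemma hRPX (W x0 y0 : ℝ) : (1 + X) * rescale (-1:ℝ) (PX W x0 y0) = M1 W x0 y0 := by
  have := congrArg (rescale (-1:ℝ)) (hPX W x0 y0)
  rw [map_mul, map_sub, map_one, rescale_X] at this
  rw [M1, ← this]
  simp

lemma dQ' (W x0 y0 : ℝ) : d⁄dX ℝ (Q W x0 y0) = PX W x0 y0 - rescale (-1:ℝ) (PX W x0 y0) := by
  ext n
  rw [coeff_derivative, map_sub, coeff_rescale]
  simp only [Q, PX, coeff_mk]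
  have h1 : ((n:ℝ)+1) ≠ 0 := by positivity
  have h4 : (-1:ℝ)^n = ep n := rfl
  rw [ep_succ, h4]
  field_simp
  ring

lemma dQ (W x0 y0 : ℝ) : (1 - X) * (1 + X) * d⁄dX ℝ (Q W x0 y0) =
    (1 + X) * P1 W x0 y0 - (1 - X) * M1 W x0 y0 := by
  rw [dQ', ← hPX, ← hRPX]
  ring

lemma rP2 (W x0 y0 : ℝ) : rescale (-1:ℝ) (P2 W x0 y0) = P2 W x0 y0 := by
  ext n
  rw [coeff_rescale]
  cases n with
  | zero => simp
  | succ n =>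
    simp only [P2, coeff_mk]
    have h4 : (-1:ℝ)^(n+1) = ep (n+1) := rfl
    rw [h4]
    have h3 := ep_mul (n+1)
    have h1 : ((n:ℝ)+1) ≠ 0 := by positivity
    field_simp
    linear_combination (-W * (xy W x0 y0 n).1) * h3

lemma ne1 : (1 + X : PowerSeries ℝ) ≠ 0 := by
  intro h
  have := congrArg (coeff 0) h
  simp at this

lemma ne2 : (1 - X : PowerSeries ℝ) ≠ 0 := by
  intro h
  have := congrArg (coeff 0) h
  simp at this

/-- abstract determinant computation -/
lemma detsys {w : ℝ} {p11 p12 p21 p22 q1 q2 m1 m2 : PowerSeries ℝ}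
    (a1 : (1 + X) * d⁄dX ℝ p11 = - p21) (a2 : (1 + X) * d⁄dX ℝ p12 = - p22)
    (b1 : (1 - X) * d⁄dX ℝ m1 = p21) (b2 : (1 - X) * d⁄dX ℝ m2 = p22)
    (c1 : X * d⁄dX ℝ p21 = C w * q1) (c2 : X * d⁄dX ℝ p22 = C w * q2)
    (e1 : (1 - X) * (1 + X) * d⁄dX ℝ q1 = (1 + X) * p11 - (1 - X) * m1)
    (e2 : (1 - X) * (1 + X) * d⁄dX ℝ q2 = (1 + X) * p12 - (1 - X) * m2) :
    X * d⁄dX ℝ (p11 * p22 - p12 * p21) = C w * (p11 * q2 - p12 * q1) ∧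
    (1 + X) * d⁄dX ℝ (p11 * q2 - p12 * q1) =
      - (p21 * q2 - p22 * q1) - (p11 * m2 - p12 * m1) ∧
    (1 + X) * d⁄dX ℝ (- (p21 * q2 - p22 * q1) - (p11 * m2 - p12 * m1)) =
      - 2 * (m1 * p22 - m2 * p21) := by
  simp only [map_sub, map_neg, Derivation.leibniz, smul_eq_mul]
  refine ⟨?_, ?_, ?_⟩
  · apply mul_left_cancel₀ ne1
    linear_combination (X * p22) * a1 - X * p21 * a2 + (1 + X) * p11 * c2 - (1 + X) * p12 * c1
  · apply mul_left_cancel₀ ne2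
    linear_combination (1 - X) * q2 * a1 - (1 - X) * q1 * a2 + p11 * e2 - p12 * e1
  · apply mul_left_cancel₀ ne2
    apply mul_left_cancel₀ (X_ne_zero (R := ℝ))
    linear_combination (-(1-X)*(1+X)*q2) * c1 + ((1-X)*(1+X)*q1) * c2 - X * p21 * e2 + X * p22 * e1
      - X * (1-X) * m2 * a1 + X * (1-X) * m1 * a2 - X * (1+X) * p11 * b2 + X * (1+X) * p12 * b1

lemma solve {W : ℝ} {D g h : PowerSeries ℝ} (hD : X * d⁄dX ℝ D = C (-(W/2)) * g)
    (hg : (1 + X) * d⁄dX ℝ g = h) (hh : (1 + X) * d⁄dX ℝ h = - 2 * rescale (-1:ℝ) D)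
    (D0 : coeff 0 D = 1) (h0 : coeff 0 h = 0) (N : ℕ) :
    coeff (N+1) g * ((N:ℝ)+1) = -2 * ep (N+1) * (ab ep W N).2 ∧
    coeff (N+1) h * ((N:ℝ)+1) = 2 * ep (N+1) * (ab ep W N).1 ∧
    ∑ i ∈ range (N+1), coeff i D = (ab ep W N).1 := by
  have rg : ∀ n : ℕ, coeff (n+2) g * ((n:ℝ)+2) + coeff (n+1) g * ((n:ℝ)+1) = coeff (n+1) h := by
    intro n
    have := congrArg (coeff (n+1)) hg
    rw [add_mul, one_mul, map_add, coeff_succ_X_mul, coeff_derivative, coeff_derivative] at this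
    push_cast at this
    linear_combination this
  have e2 : (-2 : PowerSeries ℝ) = C (-2) := by rw [map_neg, map_ofNat]
  rw [e2] at hh
  have rh : ∀ n : ℕ, coeff (n+2) h * ((n:ℝ)+2) + coeff (n+1) h * ((n:ℝ)+1) = -2 * ep (n+1) * coeff (n+1) D := by
    intro n
    have := congrArg (coeff (n+1)) hh
    rw [add_mul, one_mul, map_add, coeff_succ_X_mul, coeff_derivative, coeff_derivative, coeff_C_mul,
      coeff_rescale] at this
    push_cast at this
    unfold ep
    linear_combination this
  have rD : ∀ n : ℕ, coeff (n+1) D * ((n:ℝ)+1) = -(W/2) * coeff (n+1) g := by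
    intro n
    have := congrArg (coeff (n+1)) hD
    rw [coeff_succ_X_mul, coeff_derivative, coeff_C_mul] at this
    exact this
  induction N with
  | zero =>
    have h1 := congrArg (coeff 0) hg
    have h2 := congrArg (coeff 0) hh
    rw [add_mul, one_mul, map_add, coeff_derivative, coeff_zero_X_mul, h0] at h1
    rw [add_mul, one_mul, map_add, coeff_derivative, coeff_zero_X_mul, coeff_C_mul, coeff_rescale, D0] at h2
    simp at h1 h2
    simp [h1, h2, D0, ab, ep_succ, ep_zero]
  | succ N ih =>
    obtain ⟨i1, i2, i3⟩ := ih
    have h1 : ((N:ℝ)+1) ≠ 0 := by positivity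
    have hDN : coeff (N+1) D = W * (ep (N+1) / ((N:ℝ)+1)^2 * (ab ep W N).2) := by
      have := rD N
      field_simp
      field_simp at this
      linear_combination ((N:ℝ)+1)/2 * this - W/2 * i1
    refine ⟨?_, ?_, ?_⟩
    · have := rg N
      rw [ep_succ (N+1)]
      simp only [ab]
      push_cast
      have i2' : coeff (N+1) h = 2 * ep (N+1) * (ab ep W N).1 / ((N:ℝ)+1) := by
        rw [eq_div_iff h1]; exact i2
      rw [i2'] at this
      linear_combination this - i1
    · have := rh N
      rw [ep_succ (N+1)]
      simp only [ab]
      rw [hDN] at this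
      push_cast
      linear_combination this - i2
    · rw [sum_range_succ, i3, hDN]
      simp only [ab]

lemma summ {f : ℕ → ℝ} {a : ℝ} (h : Tendsto (fun n => ∑ i ∈ range n, f i) atTop (𝓝 a)) {t : ℝ}
    (h0 : 0 ≤ t) (h1 : t < 1) : Summable fun n => ‖f n * t ^ n‖ := by
  have h2 : Tendsto f atTop (𝓝 0) := by
    have := (h.comp (tendsto_add_atTop_nat 1)).sub h
    rw [sub_self] at this
    refine this.congr fun n => ?_
    simp [sum_range_succ]
  obtain ⟨K, hK⟩ := h2.abs.bddAbove_range
  refine Summable.of_nonneg_of_le (fun n => norm_nonneg _) (fun n => ?_)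
    ((summable_geometric_of_lt_one h0 h1).mul_left K)
  rw [norm_mul, Real.norm_eq_abs, Real.norm_eq_abs, abs_of_nonneg (by positivity : 0 ≤ t ^ n)]
  have : |f n| ≤ K := hK ⟨n, rfl⟩
  gcongr

lemma eval_mul {p q : PowerSeries ℝ} {t : ℝ} (hp : Summable fun n => ‖coeff n p * t ^ n‖)
    (hq : Summable fun n => ‖coeff n q * t ^ n‖) :
    HasSum (fun n => coeff n (p * q) * t ^ n) ((∑' n, coeff n p * t ^ n) * ∑' n, coeff n q * t ^ n) := by
  have e : ∀ n, ∑ kl ∈ antidiagonal n, (coeff kl.1 p * t ^ kl.1) * (coeff kl.2 q * t ^ kl.2) =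
      coeff n (p * q) * t ^ n := by
    intro n
    rw [coeff_mul, Finset.sum_mul]
    refine Finset.sum_congr rfl fun kl h => ?_
    rw [Finset.HasAntidiagonal.mem_antidiagonal] at h
    rw [← h, pow_add]; ring
  have h1 := summable_norm_sum_mul_antidiagonal_of_summable_norm hp hq
  have h2 := tsum_mul_tsum_eq_tsum_sum_antidiagonal_of_summable_norm hp hq
  simp only [e] at h1 h2
  rw [h2]
  exact h1.of_norm.hasSum

theorem alt_tendsto (w : ℝ) (h0 : 0 < w) (h1 : w < 1/8) :
    Tendsto (fun N => (ab ep (8*w) N).1) atTop (𝓝 (Cinf w)) := by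
  set W := 8 * w with hW
  have hW0 : 0 ≤ W := by positivity
  obtain ⟨⟨x1, hx1⟩, y1, hy1⟩ := xy_conv hW0 1 0
  obtain ⟨⟨x2, hx2⟩, y2, hy2⟩ := xy_conv hW0 0 1
  have hdet : x1 * y2 - x2 * y1 = Cinf w := by
    have h2 : Tendsto (fun k : ℕ => 2 * k) atTop atTop := tendsto_id.const_mul_atTop' two_pos
    have := ((hx1.mul hy2).sub (hx2.mul hy1)).comp h2
    refine tendsto_nhds_unique this ((CC_tendsto h0.le).congr fun k => ?_)
    exact (xy_det w k).symm
  obtain ⟨k1, k2, k3⟩ := detsys (dP1 W 1 0) (dP1 W 0 1) (dM1 W 1 0) (dM1 W 0 1) (dP2 W 1 0) (dP2 W 0 1)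
    (dQ W 1 0) (dQ W 0 1)
  have kr : M1 W 1 0 * P2 W 0 1 - M1 W 0 1 * P2 W 1 0 =
      rescale (-1:ℝ) (P1 W 1 0 * P2 W 0 1 - P1 W 0 1 * P2 W 1 0) := by
    rw [map_sub, map_mul, map_mul, rP2, rP2]; rfl
  rw [kr] at k3
  have hs := fun N => (solve k1 k2 k3 (by simp [P1, P2]) (by simp [P1, P2, M1_zero, Q]) N).2.2
  have hA := a_tendsto_zz abs_ep hW0 (by linarith : W < 1)
  set A := ∑' l, W ^ l * zz ep l
  have hD : Tendsto (fun N => ∑ i ∈ range N, coeff i (P1 W 1 0 * P2 W 0 1 - P1 W 0 1 * P2 W 1 0))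
      atTop (𝓝 A) := by
    rw [← tendsto_add_atTop_iff_nat 1]
    exact hA.congr fun N => (hs N).symm
  have t11 : Tendsto (fun N => ∑ i ∈ range N, coeff i (P1 W 1 0)) atTop (𝓝 x1) := by
    rw [← tendsto_add_atTop_iff_nat 1]
    exact hx1.congr fun N => (sum_P1 W 1 0 N).symm
  have t12 : Tendsto (fun N => ∑ i ∈ range N, coeff i (P1 W 0 1)) atTop (𝓝 x2) := by
    rw [← tendsto_add_atTop_iff_nat 1]
    exact hx2.congr fun N => (sum_P1 W 0 1 N).symm
  have t21 : Tendsto (fun N => ∑ i ∈ range N, coeff i (P2 W 1 0)) atTop (𝓝 y1) := by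
    rw [← tendsto_add_atTop_iff_nat 1]
    exact hy1.congr fun N => (sum_P2 W 1 0 N).symm
  have t22 : Tendsto (fun N => ∑ i ∈ range N, coeff i (P2 W 0 1)) atTop (𝓝 y2) := by
    rw [← tendsto_add_atTop_iff_nat 1]
    exact hy2.congr fun N => (sum_P2 W 0 1 N).symm
  have l0 := Real.tendsto_tsum_powerSeries_nhdsWithin_lt hD
  have l1 := ((Real.tendsto_tsum_powerSeries_nhdsWithin_lt t11).mul
    (Real.tendsto_tsum_powerSeries_nhdsWithin_lt t22)).sub
    ((Real.tendsto_tsum_powerSeries_nhdsWithin_lt t12).mul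
    (Real.tendsto_tsum_powerSeries_nhdsWithin_lt t21))
  rw [hdet] at l1
  have : A = Cinf w := by
    refine tendsto_nhds_unique l0 (l1.congr' ?_)
    filter_upwards [Ioo_mem_nhdsLT (zero_lt_one : (0:ℝ) < 1)] with t ht
    have s1 := eval_mul (summ t11 ht.1.le ht.2) (summ t22 ht.1.le ht.2)
    have s2 := eval_mul (summ t12 ht.1.le ht.2) (summ t21 ht.1.le ht.2)
    rw [← (s1.sub s2).tsum_eq]
    refine tsum_congr fun n => ?_
    rw [map_sub, sub_mul]
  rw [← this]
  exact hA

end ZTO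

theorem zetaTwoOne_eq_eight_pow_mul_alt (l : ℕ) (hl : 1 ≤ l) :
    zetaTwoOneRep l = 8 ^ l * zetaAltTwoOneRep l := by
  have h := ZTO.main_of (l := l) ZTO.alt_tendsto
  rw [ZTO.zz_one, ZTO.zz_ep] at h
  exact h
end
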